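/- arXiv:2112.04547 — 8 statements merged into one kernel-verified Lean document; each statement's English description precedes it below -/
import Mathlib

section
/- Fix y₁,y₂ ≥ 0 and u ∈ [−1,1], and set a = (y₁+y₂+(y₁−y₂)u)/2 and ā = (y₁+y₂−(y₁−y₂)u)/2. At any point (x₁,x₂) with x₁,x₂ > 0 and α(x,y,u)² > 4x₁x₂y₁y₂ (so that X₁ > X₂), the functions X₁ and X₂ are differentiable in (x₁,x₂) and ∂X₁/∂x₁ = (aX₁ − x₂y₁y₂)/(X₁−X₂), ∂X₁/∂x₂ = (āX₁ − x₁y₁y₂)/(X₁−X₂), ∂X₂/∂x₁ = (aX₂ − x₂y₁y₂)/(X₂−X₁), and ∂X₂/∂x₂ = (āX₂ − x₁y₁y₂)/(X₂−X₁). -/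
open Real

/-- `α(x, y, u) = ((x₁+x₂)(y₁+y₂) + (x₁−x₂)(y₁−y₂)u)/2`. -/
noncomputable def alph (x₁ x₂ y₁ y₂ u : ℝ) : ℝ :=
  ((x₁ + x₂) * (y₁ + y₂) + (x₁ - x₂) * (y₁ - y₂) * u) / 2

/-- `X₁(x, y, u) = (α + √(α² − 4x₁x₂y₁y₂))/2`. -/
noncomputable def X1 (x₁ x₂ y₁ y₂ u : ℝ) : ℝ :=
  (alph x₁ x₂ y₁ y₂ u +
    Real.sqrt ((alph x₁ x₂ y₁ y₂ u) ^ 2 - 4 * x₁ * x₂ * y₁ * y₂)) / 2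

/-- `X₂(x, y, u) = (α − √(α² − 4x₁x₂y₁y₂))/2`. -/
noncomputable def X2 (x₁ x₂ y₁ y₂ u : ℝ) : ℝ :=
  (alph x₁ x₂ y₁ y₂ u -
    Real.sqrt ((alph x₁ x₂ y₁ y₂ u) ^ 2 - 4 * x₁ * x₂ * y₁ * y₂)) / 2

/-- Derivative of the roots of `X² - A X + P` along a curve. -/
lemma root_deriv (A D : ℝ → ℝ) (a p t : ℝ) (hA : HasDerivAt A a t)
    (hD : HasDerivAt D (2 * A t * a - 4 * p) t) (h : 0 < D t) :
    HasDerivAt (fun t => (A t + Real.sqrt (D t)) / 2)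
      ((a * ((A t + Real.sqrt (D t)) / 2) - p) /
        ((A t + Real.sqrt (D t)) / 2 - (A t - Real.sqrt (D t)) / 2)) t ∧
    HasDerivAt (fun t => (A t - Real.sqrt (D t)) / 2)
      ((a * ((A t - Real.sqrt (D t)) / 2) - p) /
        ((A t - Real.sqrt (D t)) / 2 - (A t + Real.sqrt (D t)) / 2)) t := by
  have hs := Real.sqrt_pos.2 h
  have hq := hD.sqrt h.ne'
  have e1 : (A t + Real.sqrt (D t)) / 2 - (A t - Real.sqrt (D t)) / 2 = Real.sqrt (D t) := by ring
  have e2 : (A t - Real.sqrt (D t)) / 2 - (A t + Real.sqrt (D t)) / 2 = -Real.sqrt (D t) := by ring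
  rw [e1, e2]
  constructor
  · refine ((hA.add hq).div_const 2).congr_deriv ?_
    field_simp
    ring
  · refine ((hA.sub hq).div_const 2).congr_deriv ?_
    field_simp
    ring

theorem partial_derivatives_of_X1_X2
    (y₁ y₂ : ℝ) (hy₁ : 0 ≤ y₁) (hy₂ : 0 ≤ y₂)
    (u : ℝ) (hu : u ∈ Set.Icc (-1 : ℝ) 1)
    (a abar : ℝ)
    (ha : a = (y₁ + y₂ + (y₁ - y₂) * u) / 2)
    (habar : abar = (y₁ + y₂ - (y₁ - y₂) * u) / 2)
    (x₁ x₂ : ℝ) (hx₁ : 0 < x₁) (hx₂ : 0 < x₂)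
    (hdisc : (alph x₁ x₂ y₁ y₂ u) ^ 2 > 4 * x₁ * x₂ * y₁ * y₂) :
    DifferentiableAt ℝ (fun p : ℝ × ℝ => X1 p.1 p.2 y₁ y₂ u) (x₁, x₂) ∧
    DifferentiableAt ℝ (fun p : ℝ × ℝ => X2 p.1 p.2 y₁ y₂ u) (x₁, x₂) ∧
    HasDerivAt (fun t => X1 t x₂ y₁ y₂ u)
      ((a * X1 x₁ x₂ y₁ y₂ u - x₂ * y₁ * y₂) / (X1 x₁ x₂ y₁ y₂ u - X2 x₁ x₂ y₁ y₂ u)) x₁ ∧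
    HasDerivAt (fun t => X1 x₁ t y₁ y₂ u)
      ((abar * X1 x₁ x₂ y₁ y₂ u - x₁ * y₁ * y₂) / (X1 x₁ x₂ y₁ y₂ u - X2 x₁ x₂ y₁ y₂ u)) x₂ ∧
    HasDerivAt (fun t => X2 t x₂ y₁ y₂ u)
      ((a * X2 x₁ x₂ y₁ y₂ u - x₂ * y₁ * y₂) / (X2 x₁ x₂ y₁ y₂ u - X1 x₁ x₂ y₁ y₂ u)) x₁ ∧
    HasDerivAt (fun t => X2 x₁ t y₁ y₂ u)
      ((abar * X2 x₁ x₂ y₁ y₂ u - x₁ * y₁ * y₂) / (X2 x₁ x₂ y₁ y₂ u - X1 x₁ x₂ y₁ y₂ u)) x₂ := by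
  have hpos : 0 < (alph x₁ x₂ y₁ y₂ u) ^ 2 - 4 * x₁ * x₂ * y₁ * y₂ := by linarith
  have hA1 : HasDerivAt (fun t => alph t x₂ y₁ y₂ u) a x₁ := by
    have h := ((hasDerivAt_id x₁).mul_const a).add_const (x₂ * abar)
    rw [one_mul] at h
    have hf : (fun t => alph t x₂ y₁ y₂ u) = fun t => id t * a + x₂ * abar := by
      funext t
      simp only [alph, id, ha, habar]
      ring
    rw [hf]
    exact h
  have hA2 : HasDerivAt (fun t => alph x₁ t y₁ y₂ u) abar x₂ := by
    have h := ((hasDerivAt_id x₂).mul_const abar).add_const (x₁ * a)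
    rw [one_mul] at h
    have hf : (fun t => alph x₁ t y₁ y₂ u) = fun t => id t * abar + x₁ * a := by
      funext t
      simp only [alph, id, ha, habar]
      ring
    rw [hf]
    exact h
  have hD1 : HasDerivAt (fun t => (alph t x₂ y₁ y₂ u) ^ 2 - 4 * t * x₂ * y₁ * y₂)
      (2 * alph x₁ x₂ y₁ y₂ u * a - 4 * (x₂ * y₁ * y₂)) x₁ := by
    refine HasDerivAt.congr_deriv ((hA1.pow 2).sub (((((hasDerivAt_id x₁).const_mul 4).mul_const x₂).mul_const
      y₁).mul_const y₂)) ?_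
    norm_num
    ring
  have hD2 : HasDerivAt (fun t => (alph x₁ t y₁ y₂ u) ^ 2 - 4 * x₁ * t * y₁ * y₂)
      (2 * alph x₁ x₂ y₁ y₂ u * abar - 4 * (x₁ * y₁ * y₂)) x₂ := by
    refine HasDerivAt.congr_deriv ((hA2.pow 2).sub ((((hasDerivAt_id x₂).const_mul (4 * x₁)).mul_const
      y₁).mul_const y₂)) ?_
    norm_num
    ring
  have r1 := root_deriv _ _ a (x₂ * y₁ * y₂) x₁ hA1 hD1 hpos
  have r2 := root_deriv _ _ abar (x₁ * y₁ * y₂) x₂ hA2 hD2 hpos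
  have dA : DifferentiableAt ℝ (fun p : ℝ × ℝ => alph p.1 p.2 y₁ y₂ u) (x₁, x₂) := by
    unfold alph
    fun_prop
  have dD : DifferentiableAt ℝ (fun p : ℝ × ℝ =>
      Real.sqrt ((alph p.1 p.2 y₁ y₂ u) ^ 2 - 4 * p.1 * p.2 * y₁ * y₂)) (x₁, x₂) := by
    refine DifferentiableAt.sqrt ?_ hpos.ne'
    exact (dA.pow 2).sub (by fun_prop)
  have d1 := (dA.add dD).mul_const (1 / 2 : ℝ)
  have d2 := (dA.sub dD).mul_const (1 / 2 : ℝ)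
  refine ⟨d1.congr_of_eventuallyEq (Filter.Eventually.of_forall fun p => ?_),
    d2.congr_of_eventuallyEq (Filter.Eventually.of_forall fun p => ?_), r1.1, r2.1, r1.2, r2.2⟩
  · simp only [X1, Pi.add_apply]
    ring
  · simp only [X2, Pi.sub_apply]
    ring
end

section
/- Fix y₁,y₂ ≥ 0 and u ∈ [−1,1]. At any point (x₁,x₂) with x₁,x₂ > 0, x₁ ≠ x₂, and α(x,y,u)² > 4x₁x₂y₁y₂, one has (x₁²/(x₁−x₂)) ∂X₁/∂x₁ + (x₂²/(x₂−x₁)) ∂X₁/∂x₂ = X₁²/(X₁−X₂) + u x₁x₂(y₁−y₂)X₁/((x₁−x₂)(X₁−X₂)), and (x₁²/(x₁−x₂)) ∂X₂/∂x₁ + (x₂²/(x₂−x₁)) ∂X₂/∂x₂ = X₂²/(X₂−X₁) − u x₁x₂(y₁−y₂)X₂/((x₁−x₂)(X₁−X₂)). -/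
open Real

/-- Derivative of the square-root branches along a line on which `α` is affine with slope `a` and
the product is affine with slope `q`. -/
lemma branch_deriv (A P : ℝ → ℝ) (a q x ε : ℝ) (hA : HasDerivAt A a x) (hP : HasDerivAt P q x)
    (hpos : 0 < A x ^ 2 - 4 * P x) :
    HasDerivAt (fun t => (A t + ε * Real.sqrt (A t ^ 2 - 4 * P t)) / 2)
      ((a + ε * ((2 * A x * a - 4 * q) / (2 * Real.sqrt (A x ^ 2 - 4 * P x)))) / 2) x := by
  have h1 : HasDerivAt (fun t => A t ^ 2 - 4 * P t) (2 * A x * a - 4 * q) x := by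
    have h2 := (hA.pow 2).sub (hP.const_mul 4)
    exact h2.congr_deriv (by norm_num)
  exact (hA.add ((h1.sqrt hpos.ne').const_mul ε)).div_const 2

lemma alph_deriv_left (x₁ x₂ y₁ y₂ u : ℝ) :
    HasDerivAt (fun t => alph t x₂ y₁ y₂ u) ((y₁ + y₂ + (y₁ - y₂) * u) / 2) x₁ := by
  unfold alph
  have h := ((((hasDerivAt_id x₁).add_const x₂).mul_const (y₁ + y₂)).add
    ((((hasDerivAt_id x₁).sub_const x₂).mul_const (y₁ - y₂)).mul_const u)).div_const 2
  exact h.congr_deriv (by ring)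

lemma alph_deriv_right (x₁ x₂ y₁ y₂ u : ℝ) :
    HasDerivAt (fun t => alph x₁ t y₁ y₂ u) ((y₁ + y₂ - (y₁ - y₂) * u) / 2) x₂ := by
  unfold alph
  have h := ((((hasDerivAt_id x₂).const_add x₁).mul_const (y₁ + y₂)).add
    ((((hasDerivAt_id x₂).const_sub x₁).mul_const (y₁ - y₂)).mul_const u)).div_const 2
  exact h.congr_deriv (by ring)

theorem first_order_part_of_operator_on_X
    (y₁ y₂ : ℝ) (hy₁ : 0 ≤ y₁) (hy₂ : 0 ≤ y₂)
    (u : ℝ) (hu : u ∈ Set.Icc (-1 : ℝ) 1)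
    (x₁ x₂ : ℝ) (hx₁ : 0 < x₁) (hx₂ : 0 < x₂) (hne : x₁ ≠ x₂)
    (hdisc : (alph x₁ x₂ y₁ y₂ u) ^ 2 > 4 * x₁ * x₂ * y₁ * y₂) :
    x₁ ^ 2 / (x₁ - x₂) * deriv (fun t => X1 t x₂ y₁ y₂ u) x₁ +
        x₂ ^ 2 / (x₂ - x₁) * deriv (fun t => X1 x₁ t y₁ y₂ u) x₂ =
      (X1 x₁ x₂ y₁ y₂ u) ^ 2 / (X1 x₁ x₂ y₁ y₂ u - X2 x₁ x₂ y₁ y₂ u) +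
        u * x₁ * x₂ * (y₁ - y₂) * X1 x₁ x₂ y₁ y₂ u /
          ((x₁ - x₂) * (X1 x₁ x₂ y₁ y₂ u - X2 x₁ x₂ y₁ y₂ u)) ∧
    x₁ ^ 2 / (x₁ - x₂) * deriv (fun t => X2 t x₂ y₁ y₂ u) x₁ +
        x₂ ^ 2 / (x₂ - x₁) * deriv (fun t => X2 x₁ t y₁ y₂ u) x₂ =
      (X2 x₁ x₂ y₁ y₂ u) ^ 2 / (X2 x₁ x₂ y₁ y₂ u - X1 x₁ x₂ y₁ y₂ u) -
        u * x₁ * x₂ * (y₁ - y₂) * X2 x₁ x₂ y₁ y₂ u /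
          ((x₁ - x₂) * (X1 x₁ x₂ y₁ y₂ u - X2 x₁ x₂ y₁ y₂ u)) := by
  have hpos : 0 < alph x₁ x₂ y₁ y₂ u ^ 2 - 4 * (x₁ * x₂ * y₁ * y₂) := by linarith
  have hP1 : HasDerivAt (fun t => t * x₂ * y₁ * y₂) (x₂ * y₁ * y₂) x₁ := by
    exact ((((hasDerivAt_id x₁).mul_const x₂).mul_const y₁).mul_const y₂).congr_deriv (by ring)
  have hP2 : HasDerivAt (fun t => x₁ * t * y₁ * y₂) (x₁ * y₁ * y₂) x₂ := by
    exact ((((hasDerivAt_id x₂).const_mul x₁).mul_const y₁).mul_const y₂).congr_deriv (by ring)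
  have L := fun ε => (branch_deriv (fun t => alph t x₂ y₁ y₂ u) _ _ _ x₁ ε
    (alph_deriv_left x₁ x₂ y₁ y₂ u) hP1 hpos).deriv
  have R := fun ε => (branch_deriv (fun t => alph x₁ t y₁ y₂ u) _ _ _ x₂ ε
    (alph_deriv_right x₁ x₂ y₁ y₂ u) hP2 hpos).deriv
  have e1 : ∀ a b, X1 a b y₁ y₂ u = (alph a b y₁ y₂ u +
      1 * Real.sqrt (alph a b y₁ y₂ u ^ 2 - 4 * (a * b * y₁ * y₂))) / 2 := by
    intro a b
    simp only [X1, one_mul, mul_assoc]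
  have e2 : ∀ a b, X2 a b y₁ y₂ u = (alph a b y₁ y₂ u +
      (-1) * Real.sqrt (alph a b y₁ y₂ u ^ 2 - 4 * (a * b * y₁ * y₂))) / 2 := by
    intro a b
    simp only [X2, neg_mul, one_mul, mul_assoc, sub_eq_add_neg]
  simp only [e1, e2]
  rw [L, R, L, R]
  have hs := Real.sq_sqrt hpos.le
  have hs0 := (Real.sqrt_pos.mpr hpos).ne'
  have hα : alph x₁ x₂ y₁ y₂ u =
    ((x₁ + x₂) * (y₁ + y₂) + (x₁ - x₂) * (y₁ - y₂) * u) / 2 := rfl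
  generalize Real.sqrt (alph x₁ x₂ y₁ y₂ u ^ 2 - 4 * (x₁ * x₂ * y₁ * y₂)) = s at *
  generalize alph x₁ x₂ y₁ y₂ u = α at *
  have hd : x₁ - x₂ ≠ 0 := sub_ne_zero.mpr hne
  have hd2 : x₂ - x₁ = -(x₁ - x₂) := by ring
  have t1 : (α + 1 * s) / 2 - (α + -1 * s) / 2 = s := by ring
  have t2 : (α + -1 * s) / 2 - (α + 1 * s) / 2 = -s := by ring
  rw [t1, t2, hd2]
  -- both identities reduce to these, using `X² = αX - p`
  have hD : x₁ ^ 2 * ((y₁ + y₂ + (y₁ - y₂) * u) / 2) - x₂ ^ 2 * ((y₁ + y₂ - (y₁ - y₂) * u) / 2)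
      = (x₁ - x₂) * α + u * (y₁ - y₂) * x₁ * x₂ := by
    rw [hα]; ring
  generalize (y₁ + y₂ + (y₁ - y₂) * u) / 2 = a at *
  generalize (y₁ + y₂ - (y₁ - y₂) * u) / 2 = b at *
  clear hα L R e1 e2 hP1 hP2
  constructor
  · field_simp
    linear_combination (2 * (α + s)) * hD - (x₁ - x₂) * hs
  · field_simp
    linear_combination (2 * (s - α)) * hD + (x₁ - x₂) * hs
end

section
/- Fix y₁,y₂ ≥ 0 and u ∈ [−1,1]. At any point (x₁,x₂) with x₁,x₂ > 0 and α(x,y,u)² > 4x₁x₂y₁y₂, one has (x₁ ∂X₁/∂x₁)² + (x₂ ∂X₁/∂x₂)² = X₁² − x₁x₂(y₁−y₂)²X₁²(1−u²)/(2(X₁−X₂)²), and (x₁ ∂X₂/∂x₁)² + (x₂ ∂X₂/∂x₂)² = X₂² − x₁x₂(y₁−y₂)²X₂²(1−u²)/(2(X₁−X₂)²). -/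
open Real

lemma aux_alg (A B P s : ℝ) (hs : s ≠ 0) (h : s ^ 2 = (A + B) ^ 2 - 4 * P) :
    ((A * ((A + B + s) / 2) - P) / s) ^ 2 + ((B * ((A + B + s) / 2) - P) / s) ^ 2 =
      ((A + B + s) / 2) ^ 2 - 4 * (A * B - P) * ((A + B + s) / 2) ^ 2 / (2 * s ^ 2) := by
  have hP : P = ((A + B) ^ 2 - s ^ 2) / 4 := by linarith
  subst hP
  field_simp
  ring

lemma aux_deriv (f g : ℝ → ℝ) (a g' c x s : ℝ) (hf : HasDerivAt f a x)
    (hg : HasDerivAt g g' x) (hD : f x ^ 2 - g x ≠ 0) (hs : s = √(f x ^ 2 - g x)) :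
    HasDerivAt (fun t => (f t + c * √(f t ^ 2 - g t)) / 2)
      ((a + c * ((2 * f x * a - g') / (2 * s))) / 2) x := by
  subst hs
  have h := ((hf.pow 2).sub hg).sqrt hD
  have h2 := (hf.add (h.const_mul c)).div_const 2
  refine (h2.congr_deriv ?_).congr_of_eventuallyEq (Filter.Eventually.of_forall fun t => ?_)
  · simp
  · simp

theorem squared_partial_derivatives_of_X
    (y₁ y₂ : ℝ) (hy₁ : 0 ≤ y₁) (hy₂ : 0 ≤ y₂)
    (u : ℝ) (hu : u ∈ Set.Icc (-1 : ℝ) 1)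
    (x₁ x₂ : ℝ) (hx₁ : 0 < x₁) (hx₂ : 0 < x₂)
    (hdisc : (alph x₁ x₂ y₁ y₂ u) ^ 2 > 4 * x₁ * x₂ * y₁ * y₂) :
    (x₁ * deriv (fun t => X1 t x₂ y₁ y₂ u) x₁) ^ 2 +
        (x₂ * deriv (fun t => X1 x₁ t y₁ y₂ u) x₂) ^ 2 =
      (X1 x₁ x₂ y₁ y₂ u) ^ 2 -
        x₁ * x₂ * (y₁ - y₂) ^ 2 * (X1 x₁ x₂ y₁ y₂ u) ^ 2 * (1 - u ^ 2) /
          (2 * (X1 x₁ x₂ y₁ y₂ u - X2 x₁ x₂ y₁ y₂ u) ^ 2) ∧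
    (x₁ * deriv (fun t => X2 t x₂ y₁ y₂ u) x₁) ^ 2 +
        (x₂ * deriv (fun t => X2 x₁ t y₁ y₂ u) x₂) ^ 2 =
      (X2 x₁ x₂ y₁ y₂ u) ^ 2 -
        x₁ * x₂ * (y₁ - y₂) ^ 2 * (X2 x₁ x₂ y₁ y₂ u) ^ 2 * (1 - u ^ 2) /
          (2 * (X1 x₁ x₂ y₁ y₂ u - X2 x₁ x₂ y₁ y₂ u) ^ 2) := by
  have hD : alph x₁ x₂ y₁ y₂ u ^ 2 - 4 * x₁ * x₂ * y₁ * y₂ > 0 := by linarith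
  obtain ⟨s, hs⟩ : ∃ s, s = √(alph x₁ x₂ y₁ y₂ u ^ 2 - 4 * x₁ * x₂ * y₁ * y₂) := ⟨_, rfl⟩
  have hs0 : s ≠ 0 := by rw [hs]; exact (Real.sqrt_pos.2 hD).ne'
  have hs2 : s ^ 2 = alph x₁ x₂ y₁ y₂ u ^ 2 - 4 * x₁ * x₂ * y₁ * y₂ := by
    rw [hs]; exact Real.sq_sqrt hD.le
  have ha1 : HasDerivAt (fun t => alph t x₂ y₁ y₂ u) (((y₁ + y₂) + (y₁ - y₂) * u) / 2) x₁ := by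
    have h := (((hasDerivAt_id x₁).mul_const (((y₁ + y₂) + (y₁ - y₂) * u) / 2)).add_const
      (x₂ * ((y₁ + y₂) - (y₁ - y₂) * u) / 2))
    refine (h.congr_deriv (by ring)).congr_of_eventuallyEq (Filter.Eventually.of_forall fun t => ?_)
    simp only [alph, id]; ring
  have ha2 : HasDerivAt (fun t => alph x₁ t y₁ y₂ u) (((y₁ + y₂) - (y₁ - y₂) * u) / 2) x₂ := by
    have h := (((hasDerivAt_id x₂).mul_const (((y₁ + y₂) - (y₁ - y₂) * u) / 2)).add_const
      (x₁ * ((y₁ + y₂) + (y₁ - y₂) * u) / 2))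
    refine (h.congr_deriv (by ring)).congr_of_eventuallyEq (Filter.Eventually.of_forall fun t => ?_)
    simp only [alph, id]; ring
  have hg1 : HasDerivAt (fun t => 4 * t * x₂ * y₁ * y₂) (4 * x₂ * y₁ * y₂) x₁ := by
    have h := (hasDerivAt_id x₁).mul_const (4 * x₂ * y₁ * y₂)
    refine (h.congr_deriv (by ring)).congr_of_eventuallyEq (Filter.Eventually.of_forall fun t => ?_)
    simp only [id]; ring
  have hg2 : HasDerivAt (fun t => 4 * x₁ * t * y₁ * y₂) (4 * x₁ * y₁ * y₂) x₂ := by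
    have h := (hasDerivAt_id x₂).mul_const (4 * x₁ * y₁ * y₂)
    refine (h.congr_deriv (by ring)).congr_of_eventuallyEq (Filter.Eventually.of_forall fun t => ?_)
    simp only [id]; ring
  have d1 := fun c => aux_deriv _ _ _ _ c x₁ s ha1 hg1 hD.ne' hs
  have d2 := fun c => aux_deriv _ _ _ _ c x₂ s ha2 hg2 hD.ne' hs
  have hX1 : ∀ a b, X1 a b y₁ y₂ u =
      (alph a b y₁ y₂ u + 1 * √(alph a b y₁ y₂ u ^ 2 - 4 * a * b * y₁ * y₂)) / 2 := by
    intro a b; rw [X1]; ring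
  have hX2 : ∀ a b, X2 a b y₁ y₂ u =
      (alph a b y₁ y₂ u + -1 * √(alph a b y₁ y₂ u ^ 2 - 4 * a * b * y₁ * y₂)) / 2 := by
    intro a b; rw [X2]; ring
  simp only [hX1, hX2]
  rw [(d1 1).deriv, (d2 1).deriv, (d1 (-1)).deriv, (d2 (-1)).deriv]
  rw [← hs]
  obtain ⟨A, hA⟩ : ∃ A, A = x₁ * (((y₁ + y₂) + (y₁ - y₂) * u) / 2) := ⟨_, rfl⟩
  obtain ⟨B, hB⟩ : ∃ B, B = x₂ * (((y₁ + y₂) - (y₁ - y₂) * u) / 2) := ⟨_, rfl⟩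
  have hα : alph x₁ x₂ y₁ y₂ u = A + B := by rw [hA, hB, alph]; ring
  have hAB : x₁ * x₂ * (y₁ - y₂) ^ 2 * (1 - u ^ 2) = 4 * (A * B - x₁ * x₂ * y₁ * y₂) := by
    rw [hA, hB]; ring
  rw [hα] at hs2 ⊢
  have k1 := aux_alg A B (x₁ * x₂ * y₁ * y₂) s hs0 (by rw [hs2]; ring)
  have k2 := aux_alg A B (x₁ * x₂ * y₁ * y₂) (-s) (neg_ne_zero.2 hs0) (by rw [neg_sq, hs2]; ring)
  rw [← hAB] at k1 k2
  constructor
  · convert k1 using 1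
    · congr 2
      · generalize A + B = C
        rw [hA]; field_simp; ring
      · generalize A + B = C
        rw [hB]; field_simp; ring
    · ring
  · convert k2 using 1
    · congr 2
      · generalize A + B = C
        rw [hA]; field_simp; ring
      · generalize A + B = C
        rw [hB]; field_simp; ring
    · ring
end

section
/- Fix y₁,y₂ ≥ 0 and u ∈ [−1,1]. At any point (x₁,x₂) with x₁,x₂ > 0 and α(x,y,u)² > 4x₁x₂y₁y₂, one has 2x₁²(∂X₁/∂x₁)(∂X₂/∂x₁) + 2x₂²(∂X₁/∂x₂)(∂X₂/∂x₂) = x₁²x₂²y₁y₂(y₁−y₂)²(1−u²)/(X₁−X₂)². -/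
open Real

/-- Derivatives of the two roots `(A ± √(A² - c t))/2` with `A` affine in `t`. -/
lemma roots_deriv (f : ℝ → ℝ) (a c x : ℝ) (hf : HasDerivAt f a x)
    (hD : 0 < f x ^ 2 - c * x) :
    deriv (fun t => (f t + Real.sqrt (f t ^ 2 - c * t)) / 2) x *
      deriv (fun t => (f t - Real.sqrt (f t ^ 2 - c * t)) / 2) x =
      (a ^ 2 - (2 * f x * a - c) ^ 2 / (4 * (f x ^ 2 - c * x))) / 4 := by
  have h1 : HasDerivAt (fun t => f t ^ 2 - c * t) (2 * f x * a - c) x := by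
    have h := (hf.pow 2).sub ((hasDerivAt_id x).const_mul c)
    exact h.congr_deriv (by simp)
  have h2 := h1.sqrt hD.ne'
  have h3 := ((hf.add h2).div_const 2).deriv
  have h4 := ((hf.sub h2).div_const 2).deriv
  have e3 : deriv (fun t => (f t + Real.sqrt (f t ^ 2 - c * t)) / 2) x = _ := h3
  have e4 : deriv (fun t => (f t - Real.sqrt (f t ^ 2 - c * t)) / 2) x = _ := h4
  rw [e3, e4]
  have hS := Real.sqrt_pos.mpr hD
  have hq := Real.sq_sqrt hD.le
  generalize Real.sqrt (f x ^ 2 - c * x) = S at *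
  rw [← hq]
  field_simp
  ring

theorem mixed_product_of_partial_derivatives_of_X
    (y₁ y₂ : ℝ) (hy₁ : 0 ≤ y₁) (hy₂ : 0 ≤ y₂)
    (u : ℝ) (hu : u ∈ Set.Icc (-1 : ℝ) 1)
    (x₁ x₂ : ℝ) (hx₁ : 0 < x₁) (hx₂ : 0 < x₂)
    (hdisc : (alph x₁ x₂ y₁ y₂ u) ^ 2 > 4 * x₁ * x₂ * y₁ * y₂) :
    2 * x₁ ^ 2 * deriv (fun t => X1 t x₂ y₁ y₂ u) x₁ * deriv (fun t => X2 t x₂ y₁ y₂ u) x₁ +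
        2 * x₂ ^ 2 * deriv (fun t => X1 x₁ t y₁ y₂ u) x₂ * deriv (fun t => X2 x₁ t y₁ y₂ u) x₂ =
      x₁ ^ 2 * x₂ ^ 2 * y₁ * y₂ * (y₁ - y₂) ^ 2 * (1 - u ^ 2) /
        (X1 x₁ x₂ y₁ y₂ u - X2 x₁ x₂ y₁ y₂ u) ^ 2 := by
  have hD : 0 < (alph x₁ x₂ y₁ y₂ u) ^ 2 - 4 * x₁ * x₂ * y₁ * y₂ := by linarith
  have ha : HasDerivAt (fun t => alph t x₂ y₁ y₂ u)
      (((y₁ + y₂) + (y₁ - y₂) * u) / 2) x₁ := by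
    have h := (((((hasDerivAt_id x₁).add_const x₂).mul_const (y₁ + y₂)).add
      ((((hasDerivAt_id x₁).sub_const x₂).mul_const (y₁ - y₂)).mul_const u)).div_const 2)
    exact h.congr_deriv (by ring)
  have hb : HasDerivAt (fun t => alph x₁ t y₁ y₂ u)
      (((y₁ + y₂) - (y₁ - y₂) * u) / 2) x₂ := by
    have h := (((((hasDerivAt_id x₂).const_add x₁).mul_const (y₁ + y₂)).add
      ((((hasDerivAt_id x₂).const_sub x₁).mul_const (y₁ - y₂)).mul_const u)).div_const 2)
    exact h.congr_deriv (by ring)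
  have k1 := roots_deriv _ _ (4 * x₂ * y₁ * y₂) x₁ ha (by linarith)
  have k2 := roots_deriv _ _ (4 * x₁ * y₁ * y₂) x₂ hb (by linarith)
  have r1 : ∀ t, 4 * x₂ * y₁ * y₂ * t = 4 * t * x₂ * y₁ * y₂ := fun t => by ring
  have r2 : ∀ t, 4 * x₁ * y₁ * y₂ * t = 4 * x₁ * t * y₁ * y₂ := fun t => by ring
  simp only [r1] at k1
  simp only [r2] at k2
  have hX : (X1 x₁ x₂ y₁ y₂ u - X2 x₁ x₂ y₁ y₂ u) ^ 2 =
      (alph x₁ x₂ y₁ y₂ u) ^ 2 - 4 * x₁ * x₂ * y₁ * y₂ := by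
    rw [← Real.sq_sqrt hD.le]
    unfold X1 X2
    ring
  rw [hX, mul_assoc (2 * x₁ ^ 2), mul_assoc (2 * x₂ ^ 2)]
  unfold X1 X2
  rw [k1, k2]
  have hα : alph x₁ x₂ y₁ y₂ u =
      ((x₁ + x₂) * (y₁ + y₂) + (x₁ - x₂) * (y₁ - y₂) * u) / 2 := rfl
  obtain ⟨D, hDe⟩ : ∃ D, D = (alph x₁ x₂ y₁ y₂ u) ^ 2 - 4 * x₁ * x₂ * y₁ * y₂ := ⟨_, rfl⟩
  rw [← hDe] at hD ⊢
  have hne := hD.ne'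
  field_simp
  rw [hDe, hα]
  ring
end

section
/- Fix x₁,x₂,y₁,y₂ ≥ 0. At any u ∈ (−1,1) with α(x,y,u)² > 4x₁x₂y₁y₂, the functions u ↦ X₁(x,y,u) and u ↦ X₂(x,y,u) are differentiable with ∂X₁/∂u = (x₁−x₂)(y₁−y₂)X₁/(2(X₁−X₂)) and ∂X₂/∂u = −(x₁−x₂)(y₁−y₂)X₂/(2(X₁−X₂)); consequently (∂X₁/∂u)² = (x₁−x₂)²(y₁−y₂)²X₁²/(4(X₁−X₂)²), (∂X₂/∂u)² = (x₁−x₂)²(y₁−y₂)²X₂²/(4(X₁−X₂)²), and (∂X₁/∂u)(∂X₂/∂u) = −x₁x₂y₁y₂(x₁−x₂)²(y₁−y₂)²/(4(X₁−X₂)²). -/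
open Real

theorem u_derivatives_of_X
    (x₁ x₂ y₁ y₂ : ℝ) (hx₁ : 0 ≤ x₁) (hx₂ : 0 ≤ x₂) (hy₁ : 0 ≤ y₁) (hy₂ : 0 ≤ y₂)
    (u : ℝ) (hu : u ∈ Set.Ioo (-1 : ℝ) 1)
    (hdisc : (alph x₁ x₂ y₁ y₂ u) ^ 2 > 4 * x₁ * x₂ * y₁ * y₂) :
    HasDerivAt (fun t => X1 x₁ x₂ y₁ y₂ t)
      ((x₁ - x₂) * (y₁ - y₂) * X1 x₁ x₂ y₁ y₂ u /
        (2 * (X1 x₁ x₂ y₁ y₂ u - X2 x₁ x₂ y₁ y₂ u))) u ∧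
    HasDerivAt (fun t => X2 x₁ x₂ y₁ y₂ t)
      (-((x₁ - x₂) * (y₁ - y₂) * X2 x₁ x₂ y₁ y₂ u /
        (2 * (X1 x₁ x₂ y₁ y₂ u - X2 x₁ x₂ y₁ y₂ u)))) u ∧
    (deriv (fun t => X1 x₁ x₂ y₁ y₂ t) u) ^ 2 =
      (x₁ - x₂) ^ 2 * (y₁ - y₂) ^ 2 * (X1 x₁ x₂ y₁ y₂ u) ^ 2 /
        (4 * (X1 x₁ x₂ y₁ y₂ u - X2 x₁ x₂ y₁ y₂ u) ^ 2) ∧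
    (deriv (fun t => X2 x₁ x₂ y₁ y₂ t) u) ^ 2 =
      (x₁ - x₂) ^ 2 * (y₁ - y₂) ^ 2 * (X2 x₁ x₂ y₁ y₂ u) ^ 2 /
        (4 * (X1 x₁ x₂ y₁ y₂ u - X2 x₁ x₂ y₁ y₂ u) ^ 2) ∧
    deriv (fun t => X1 x₁ x₂ y₁ y₂ t) u * deriv (fun t => X2 x₁ x₂ y₁ y₂ t) u =
      -(x₁ * x₂ * y₁ * y₂ * (x₁ - x₂) ^ 2 * (y₁ - y₂) ^ 2) /
        (4 * (X1 x₁ x₂ y₁ y₂ u - X2 x₁ x₂ y₁ y₂ u) ^ 2) := by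
  have hpos : 0 < (alph x₁ x₂ y₁ y₂ u) ^ 2 - 4 * x₁ * x₂ * y₁ * y₂ := by linarith
  have hs : 0 < Real.sqrt ((alph x₁ x₂ y₁ y₂ u) ^ 2 - 4 * x₁ * x₂ * y₁ * y₂) :=
    Real.sqrt_pos.mpr hpos
  have hsq := Real.sq_sqrt hpos.le
  have ha : HasDerivAt (fun t => alph x₁ x₂ y₁ y₂ t) ((x₁ - x₂) * (y₁ - y₂) / 2) u := by
    have h := ((((hasDerivAt_id u).const_mul ((x₁ - x₂) * (y₁ - y₂))).const_add
      ((x₁ + x₂) * (y₁ + y₂))).div_const 2)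
    simpa [alph] using h
  have hr := ((ha.pow 2).sub_const (4 * x₁ * x₂ * y₁ * y₂)).sqrt hpos.ne'
  have hdiff : X1 x₁ x₂ y₁ y₂ u - X2 x₁ x₂ y₁ y₂ u =
      Real.sqrt ((alph x₁ x₂ y₁ y₂ u) ^ 2 - 4 * x₁ * x₂ * y₁ * y₂) := by
    unfold X1 X2; ring
  have hprod : X1 x₁ x₂ y₁ y₂ u * X2 x₁ x₂ y₁ y₂ u = x₁ * x₂ * y₁ * y₂ := by
    unfold X1 X2; linear_combination (-1 / 4) * hsq
  have h1 : HasDerivAt (fun t => X1 x₁ x₂ y₁ y₂ t)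
      ((x₁ - x₂) * (y₁ - y₂) * X1 x₁ x₂ y₁ y₂ u /
        (2 * (X1 x₁ x₂ y₁ y₂ u - X2 x₁ x₂ y₁ y₂ u))) u := by
    rw [hdiff]
    refine ((ha.add hr).div_const 2).congr_deriv ?_
    simp only [X1, Pi.pow_apply]
    clear hdiff hsq hr
    generalize Real.sqrt ((alph x₁ x₂ y₁ y₂ u) ^ 2 - 4 * x₁ * x₂ * y₁ * y₂) = s at hs ⊢
    have hs0 := hs.ne'
    field_simp
    try norm_num
    try ring
  have h2 : HasDerivAt (fun t => X2 x₁ x₂ y₁ y₂ t)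
      (-((x₁ - x₂) * (y₁ - y₂) * X2 x₁ x₂ y₁ y₂ u /
        (2 * (X1 x₁ x₂ y₁ y₂ u - X2 x₁ x₂ y₁ y₂ u)))) u := by
    rw [hdiff]
    refine ((ha.sub hr).div_const 2).congr_deriv ?_
    simp only [X2, Pi.pow_apply]
    clear hdiff hsq hr
    generalize Real.sqrt ((alph x₁ x₂ y₁ y₂ u) ^ 2 - 4 * x₁ * x₂ * y₁ * y₂) = s at hs ⊢
    have hs0 := hs.ne'
    field_simp
    try norm_num
    try ring
  refine ⟨h1, h2, ?_, ?_, ?_⟩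
  · rw [h1.deriv, div_pow]; ring
  · rw [h2.deriv, neg_sq, div_pow]; ring
  · rw [h1.deriv, h2.deriv, ← hprod, hdiff]
    field_simp
    try norm_num
end

section
/- Let k > 0 and x ∈ ℝ. Then lim_{ℓ→∞} (1 − x²/ℓ²)^ℓ · (∫_{−1}^{1} (1 + ux/ℓ)^ℓ (1−u²)^{k−1} du) / (∫_{−1}^{1} (1−u²)^{k−1} du) = (Γ(k+1/2)/(√π Γ(k))) ∫_{−1}^{1} e^{ux} (1−u²)^{k−1} du. (The left-hand side is the normalized two-variable Jack polynomial ratio P_{(2ℓ,ℓ)}(1+x/ℓ, 1−x/ℓ)/P_{(2ℓ,ℓ)}(1,1).) -/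
open Real Filter intervalIntegral

lemma jr_beta (k : ℝ) (hk : 0 < k) :
    ∫ x in (0 : ℝ)..1, x ^ (k - 1) * (1 - x) ^ (k - 1) = Gamma k * Gamma k / Gamma (k + k) := by
  have h := ProbabilityTheory.beta_eq_betaIntegralReal k k hk hk
  have h2 : Complex.betaIntegral k k
      = ((∫ x in (0 : ℝ)..1, x ^ (k - 1) * (1 - x) ^ (k - 1) : ℝ) : ℂ) := by
    rw [Complex.betaIntegral, ← intervalIntegral.integral_ofReal]
    refine intervalIntegral.integral_congr fun x hx => ?_
    rw [Set.uIcc_of_le zero_le_one] at hx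
    have h1 : (0 : ℝ) ≤ 1 - x := by linarith [hx.2]
    rw [Complex.ofReal_mul, Complex.ofReal_cpow hx.1, Complex.ofReal_cpow h1]
    push_cast
    rfl
  rw [h2, Complex.ofReal_re] at h
  rw [← h, ProbabilityTheory.beta]

lemma jr_norm (k : ℝ) (hk : 0 < k) :
    ∫ u in (-1 : ℝ)..1, (1 - u ^ 2) ^ (k - 1) = √π * Gamma k / Gamma (k + 1 / 2) := by
  have h := intervalIntegral.smul_integral_comp_mul_sub (a := 0) (b := 1)
    (fun u : ℝ => (1 - u ^ 2) ^ (k - 1)) 2 1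
  have e1 : (2 : ℝ) * 0 - 1 = -1 := by norm_num
  have e2 : (2 : ℝ) * 1 - 1 = 1 := by norm_num
  rw [e1, e2] at h
  rw [← h]
  have h3 : ∫ x in (0 : ℝ)..1, (1 - (2 * x - 1) ^ 2) ^ (k - 1)
      = ∫ x in (0 : ℝ)..1, (4 : ℝ) ^ (k - 1) * (x ^ (k - 1) * (1 - x) ^ (k - 1)) := by
    refine intervalIntegral.integral_congr fun x hx => ?_
    rw [Set.uIcc_of_le zero_le_one] at hx
    have h1 : (0 : ℝ) ≤ 1 - x := by linarith [hx.2]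
    rw [← Real.mul_rpow hx.1 h1, ← Real.mul_rpow (by norm_num) (mul_nonneg hx.1 h1)]
    congr 1
    ring
  rw [h3, intervalIntegral.integral_const_mul, jr_beta k hk, smul_eq_mul]
  have hd := Real.Gamma_mul_Gamma_add_half k
  have g1 := (Real.Gamma_pos_of_pos hk).ne'
  have g2 := (Real.Gamma_pos_of_pos (by linarith : 0 < k + 1 / 2)).ne'
  have g3 := (Real.Gamma_pos_of_pos (by linarith : 0 < k + k)).ne'
  have h4 : (2 : ℝ) * 4 ^ (k - 1) * 2 ^ (1 - 2 * k) = 1 := by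
    have : (4 : ℝ) ^ (k - 1) = 2 ^ (2 * (k - 1)) := by
      rw [Real.rpow_mul (by norm_num)]; norm_num
    rw [this, mul_assoc, ← Real.rpow_add (by norm_num)]
    ring_nf
    rw [Real.rpow_neg_one]; norm_num
  rw [← two_mul] at g3 ⊢
  rw [eq_div_iff g2]
  calc 2 * (4 ^ (k - 1) * (Gamma k * Gamma k / Gamma (2 * k))) * Gamma (k + 1 / 2)
      = 2 * 4 ^ (k - 1) * Gamma k / Gamma (2 * k) * (Gamma k * Gamma (k + 1 / 2)) := by ring
    _ = (2 * 4 ^ (k - 1) * 2 ^ (1 - 2 * k)) * (√π * Gamma k) * (Gamma (2 * k) / Gamma (2 * k)) := by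
        rw [hd]; ring
    _ = _ := by rw [h4, div_self g3]; ring

lemma jr_bound (n : ℕ) (y : ℝ) : |(1 + y / n) ^ n| ≤ exp |y| := by
  rcases Nat.eq_zero_or_pos n with rfl | hn
  · simp
  have hn' : (0 : ℝ) < n := by exact_mod_cast hn
  rw [abs_pow]
  have h : |1 + y / n| ≤ exp (|y| / n) := by
    calc |1 + y / n| ≤ |1| + |y / n| := abs_add_le _ _
      _ = |y| / n + 1 := by rw [abs_one, abs_div, abs_of_pos hn']; ring
      _ ≤ _ := Real.add_one_le_exp _
  calc |1 + y / n| ^ n ≤ exp (|y| / n) ^ n := pow_le_pow_left₀ (abs_nonneg _) h n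
    _ = exp |y| := by rw [← Real.exp_nat_mul]; congr 1; field_simp

theorem jack_ratio_limit_to_bessel_integral (k : ℝ) (hk : 0 < k) (x : ℝ) :
    Tendsto
      (fun ℓ : ℕ =>
        (1 - x ^ 2 / (ℓ : ℝ) ^ 2) ^ ℓ *
            (∫ u in (-1 : ℝ)..1, (1 + u * x / (ℓ : ℝ)) ^ ℓ * (1 - u ^ 2) ^ (k - 1)) /
          ∫ u in (-1 : ℝ)..1, (1 - u ^ 2) ^ (k - 1))
      atTop
      (nhds ((Real.Gamma (k + 1 / 2) / (Real.sqrt Real.pi * Real.Gamma k)) *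
        ∫ u in (-1 : ℝ)..1, Real.exp (u * x) * (1 - u ^ 2) ^ (k - 1))) := by
  have hN := jr_norm k hk
  have g1 := Real.Gamma_pos_of_pos hk
  have g2 := Real.Gamma_pos_of_pos (by linarith : 0 < k + 1 / 2)
  have hpi : 0 < √π := Real.sqrt_pos.mpr Real.pi_pos
  have hint : IntervalIntegrable (fun u : ℝ => (1 - u ^ 2) ^ (k - 1)) MeasureTheory.volume (-1) 1 := by
    by_contra hc
    rw [intervalIntegral.integral_undef hc] at hN
    have : 0 < √π * Gamma k / Gamma (k + 1 / 2) := by positivity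
    linarith
  have hA : Tendsto (fun ℓ : ℕ => (1 - x ^ 2 / (ℓ : ℝ) ^ 2) ^ ℓ) atTop (nhds 1) := by
    have h := (Real.tendsto_one_add_div_pow_exp x).mul (Real.tendsto_one_add_div_pow_exp (-x))
    rw [← Real.exp_add, add_neg_cancel, Real.exp_zero] at h
    refine h.congr fun n => ?_
    rw [← mul_pow]
    congr 1
    ring
  have hB : Tendsto (fun ℓ : ℕ =>
      ∫ u in (-1 : ℝ)..1, (1 + u * x / (ℓ : ℝ)) ^ ℓ * (1 - u ^ 2) ^ (k - 1)) atTop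
      (nhds (∫ u in (-1 : ℝ)..1, Real.exp (u * x) * (1 - u ^ 2) ^ (k - 1))) := by
    refine intervalIntegral.tendsto_integral_filter_of_dominated_convergence
      (fun u => exp |x| * (1 - u ^ 2) ^ (k - 1)) ?_ ?_ (hint.const_mul _) ?_
    · refine Eventually.of_forall fun n => ?_
      exact (by fun_prop : Measurable fun u : ℝ =>
        (1 + u * x / (n : ℝ)) ^ n * (1 - u ^ 2) ^ (k - 1)).aestronglyMeasurable
    · refine Eventually.of_forall fun n => Eventually.of_forall fun u hu => ?_
      rw [Set.uIoc_of_le (by norm_num)] at hu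
      have h1 : (0 : ℝ) ≤ 1 - u ^ 2 := by nlinarith [hu.1, hu.2]
      rw [Real.norm_eq_abs, abs_mul, abs_of_nonneg (Real.rpow_nonneg h1 _)]
      refine mul_le_mul_of_nonneg_right ((jr_bound n (u * x)).trans ?_) (Real.rpow_nonneg h1 _)
      rw [Real.exp_le_exp, abs_mul]
      exact mul_le_of_le_one_left (abs_nonneg _) (abs_le.mpr ⟨hu.1.le, hu.2⟩)
    · exact Eventually.of_forall fun u _ =>
        (Real.tendsto_one_add_div_pow_exp (u * x)).mul_const _
  have h := (hA.mul hB).div_const (∫ u in (-1 : ℝ)..1, (1 - u ^ 2) ^ (k - 1))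
  convert h using 2
  rw [hN, one_mul, div_div_eq_mul_div]
  ring
end

section
/- Let k > 0 be real and m,ℓ ≥ 0 integers, and define f(x₁,x₂) = (x₁x₂)^ℓ ∫_{−1}^{1} ((x₁+x₂)/2 + u(x₁−x₂)/2)^m (1−u²)^{k−1} du. Then for all (x₁,x₂) with x₁ ≠ x₂, (Λ_k f)(x₁,x₂) = e·f(x₁,x₂) with eigenvalue e = (m+ℓ)(m+ℓ+2k−1) + ℓ(ℓ−1). -/
open Real

/-- Integral representation of the two-variable Jack polynomial `P_{(m+ℓ, ℓ)}`
with parameter `k > 0`. -/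
noncomputable def JackP (k : ℝ) (m ℓ : ℕ) (x₁ x₂ : ℝ) : ℝ :=
  (Real.Gamma (m + 2 * k) / ((2 : ℝ) ^ (2 * k - 1) * Real.Gamma k * Real.Gamma (m + k))) *
    ((x₁ * x₂) ^ ℓ *
      ∫ u in (-1 : ℝ)..1, ((x₁ + x₂) / 2 + u * (x₁ - x₂) / 2) ^ m * (1 - u ^ 2) ^ (k - 1))

/-- The Laplace–Beltrami-type operator `Λ_k`. -/
noncomputable def Lam (k : ℝ) (f : ℝ → ℝ → ℝ) (x₁ x₂ : ℝ) : ℝ :=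
  x₁ ^ 2 * deriv (deriv (fun s => f s x₂)) x₁ +
    x₂ ^ 2 * deriv (deriv (fun s => f x₁ s)) x₂ +
    2 * k * (x₁ ^ 2 / (x₁ - x₂) * deriv (fun s => f s x₂) x₁ +
      x₂ ^ 2 / (x₂ - x₁) * deriv (fun s => f x₁ s) x₂)

/-- The normalized modified Bessel function of the first kind,
`𝓘_ν(t) = Γ(ν+1) Σ_{m≥0} (t/2)^{2m}/(m! Γ(m+ν+1))`. -/
noncomputable def besselI (ν t : ℝ) : ℝ :=
  Real.Gamma (ν + 1) *
    ∑' m : ℕ, (t / 2) ^ (2 * m) / ((m.factorial : ℝ) * Real.Gamma (m + ν + 1))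

lemma jw_int (k : ℝ) (hk : 0 < k) :
    IntervalIntegrable (fun u : ℝ => (1 - u ^ 2) ^ (k - 1)) MeasureTheory.volume (-1) 1 := by
  have h1 : IntervalIntegrable (fun u : ℝ => (1 - u ^ 2) ^ (k - 1)) MeasureTheory.volume 0 1 := by
    have h0 : IntervalIntegrable (fun u : ℝ => u ^ (k - 1)) MeasureTheory.volume 1 0 :=
      intervalIntegral.intervalIntegrable_rpow' (by linarith)
    have h2 := h0.comp_sub_left 1
    simp only [sub_self, sub_zero] at h2
    have h3 : ContinuousOn (fun u : ℝ => (1 + u) ^ (k - 1)) (Set.uIcc 0 1) := by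
      intro u hu
      rw [Set.uIcc_of_le zero_le_one] at hu
      apply ContinuousAt.continuousWithinAt
      apply ContinuousAt.rpow_const (by fun_prop)
      left; linarith [hu.1]
    refine (h2.mul_continuousOn h3).congr ?_
    intro u hu
    rw [Set.uIoc_of_le zero_le_one] at hu
    simp only
    rw [← Real.mul_rpow (by linarith [hu.2]) (by linarith [hu.1])]
    congr 1; ring
  have h2 := h1.symm.comp_sub_left 0
  simp only [sub_zero, zero_sub, neg_sq] at h2
  exact h2.trans h1

lemma jw_int' (k : ℝ) (hk : 0 < k) (c : ℝ → ℝ) (hc : Continuous c) :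
    IntervalIntegrable (fun u : ℝ => c u * (1 - u ^ 2) ^ (k - 1)) MeasureTheory.volume (-1) 1 :=
  (jw_int k hk).continuousOn_mul hc.continuousOn

lemma jw_deriv (k : ℝ) (hk : 0 < k) (n : ℕ) (a b c : ℝ → ℝ) (ha : Continuous a)
    (hb : Continuous b) (hc : Continuous c) (x : ℝ) :
    HasDerivAt (fun s => ∫ u in (-1 : ℝ)..1, ((a u * s + b u) ^ n * c u) * (1 - u ^ 2) ^ (k - 1))
      (∫ u in (-1 : ℝ)..1, ((a u * x + b u) ^ (n - 1) * (n * a u * c u)) * (1 - u ^ 2) ^ (k - 1))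
      x := by
  refine (intervalIntegral.hasDerivAt_integral_of_dominated_loc_of_deriv_le
    (F := fun s u => ((a u * s + b u) ^ n * c u) * (1 - u ^ 2) ^ (k - 1))
    (F' := fun s u => ((a u * s + b u) ^ (n - 1) * (n * a u * c u)) * (1 - u ^ 2) ^ (k - 1))
    (bound := fun u => |((|a u| * (|x| + 1) + |b u|) ^ (n - 1) * (n * |a u| * |c u|))
      * (1 - u ^ 2) ^ (k - 1)|)
    (Metric.ball_mem_nhds x one_pos) ?_ ?_ ?_ ?_ ?_ ?_).2
  · refine Filter.Eventually.of_forall fun s => ?_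
    have := (jw_int' k hk (fun u => (a u * s + b u) ^ n * c u) (by fun_prop)).def'
    exact this.aestronglyMeasurable
  · exact jw_int' k hk (fun u => (a u * x + b u) ^ n * c u) (by fun_prop)
  · have := (jw_int' k hk (fun u => (a u * x + b u) ^ (n - 1) * (n * a u * c u))
      (by fun_prop)).def'
    exact this.aestronglyMeasurable
  · refine Filter.Eventually.of_forall fun u _ s hs => ?_
    rw [Real.norm_eq_abs, abs_mul, abs_mul _ ((1 - u ^ 2) ^ (k - 1))]
    refine mul_le_mul_of_nonneg_right ?_ (abs_nonneg _)
    rw [abs_mul, abs_pow, abs_mul, abs_mul, Nat.abs_cast]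
    refine le_trans ?_ (le_abs_self _)
    have hs' : |s| ≤ |x| + 1 := by
      rw [Metric.mem_ball, Real.dist_eq] at hs
      have := abs_sub_abs_le_abs_sub s x
      linarith
    have : |a u * s + b u| ≤ |a u| * (|x| + 1) + |b u| := by
      refine (abs_add_le _ _).trans ?_
      rw [abs_mul]; gcongr
    gcongr
  · exact (jw_int' k hk (fun u => (|a u| * (|x| + 1) + |b u|) ^ (n - 1) * (n * |a u| * |c u|))
      (by fun_prop)).abs
  · refine Filter.Eventually.of_forall fun u _ s _ => ?_
    have h := ((((hasDerivAt_id s).const_mul (a u)).add_const (b u)).pow n).mul_const (c u)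
      |>.mul_const ((1 - u ^ 2) ^ (k - 1))
    refine HasDerivAt.congr_deriv (f' := _) h ?_
    simp only [id]; ring

lemma jw_prod (ℓ : ℕ) (y x : ℝ) (F g g1 : ℝ → ℝ) (g2 : ℝ)
    (hF : ∀ s, F s = (s * y) ^ ℓ * g s)
    (hg : ∀ s, HasDerivAt g (g1 s) s) (hg1 : HasDerivAt g1 g2 x) :
    x * deriv F x = (x * y) ^ ℓ * (ℓ * g x + x * g1 x) ∧
    x ^ 2 * deriv (deriv F) x =
      (x * y) ^ ℓ * (ℓ * (ℓ - 1) * g x + 2 * ℓ * x * g1 x + x ^ 2 * g2) := by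
  have hp : ∀ (n : ℕ) (s : ℝ), HasDerivAt (fun s => (s * y) ^ n) (n * (s * y) ^ (n - 1) * y) s := by
    intro n s
    have := ((hasDerivAt_id s).mul_const y).pow n
    refine HasDerivAt.congr_deriv (f' := _) this ?_
    simp
  have e : F = fun s => (s * y) ^ ℓ * g s := funext hF
  have d1 : deriv F = fun s => ℓ * (s * y) ^ (ℓ - 1) * y * g s + (s * y) ^ ℓ * g1 s := by
    funext s
    rw [e]
    exact ((hp ℓ s).mul (hg s)).deriv
  have d2 : deriv (deriv F) x = (ℓ * (((ℓ - 1 : ℕ) : ℝ) * (x * y) ^ (ℓ - 1 - 1) * y) * y * g x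
      + ℓ * (x * y) ^ (ℓ - 1) * y * g1 x) +
      (ℓ * (x * y) ^ (ℓ - 1) * y * g1 x + (x * y) ^ ℓ * g2) := by
    rw [d1]
    exact (((((hp (ℓ - 1) x).const_mul (ℓ : ℝ)).mul_const y).mul (hg x)).add
      ((hp ℓ x).mul hg1)).deriv
  rw [d2, d1]
  rcases ℓ with _ | _ | n
  · simp
  · simp; constructor <;> ring
  · simp only [Nat.add_sub_cancel]
    push_cast
    constructor <;> ring

lemma jw_main (k : ℝ) (hk : 0 < k) (m : ℕ) (x y : ℝ) :
    ∫ u in (-1 : ℝ)..1, (m * (x * y) * (2 * k * u * ((x + y) / 2 + u * (x - y) / 2) ^ (m - 1)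
      - ((m - 1 : ℕ) : ℝ) * ((x + y) / 2 + u * (x - y) / 2) ^ (m - 1 - 1) * ((x - y) / 2)
        * (1 - u ^ 2))) * (1 - u ^ 2) ^ (k - 1) = 0 := by
  have := intervalIntegral.integral_eq_sub_of_hasDerivAt_of_le (a := -1) (b := 1)
    (f := fun u : ℝ => -(m * (x * y) *
      (((x + y) / 2 + u * (x - y) / 2) ^ (m - 1) * (1 - u ^ 2) ^ k)))
    (f' := fun u : ℝ => (m * (x * y) * (2 * k * u * ((x + y) / 2 + u * (x - y) / 2) ^ (m - 1)
      - ((m - 1 : ℕ) : ℝ) * ((x + y) / 2 + u * (x - y) / 2) ^ (m - 1 - 1) * ((x - y) / 2)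
        * (1 - u ^ 2))) * (1 - u ^ 2) ^ (k - 1)) (by norm_num) ?_ ?_ ?_
  · rw [this]; simp [Real.zero_rpow hk.ne']
  · apply Continuous.continuousOn
    have : Continuous fun u : ℝ => (1 - u ^ 2) ^ k :=
      Continuous.rpow_const (by fun_prop) (fun _ => Or.inr hk.le)
    fun_prop
  · intro u hu
    have hpos : 0 < 1 - u ^ 2 := by nlinarith [hu.1, hu.2]
    have h1 : HasDerivAt (fun u : ℝ => (x + y) / 2 + u * (x - y) / 2) ((x - y) / 2) u := by
      have := (((hasDerivAt_id u).mul_const (x - y)).div_const 2).const_add ((x + y) / 2)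
      refine HasDerivAt.congr_deriv (f' := _) this ?_
      simp
    have h2 : HasDerivAt (fun u : ℝ => 1 - u ^ 2) (-(2 * u)) u := by
      have := (hasDerivAt_pow 2 u).const_sub 1
      refine HasDerivAt.congr_deriv (f' := _) this ?_
      simp
    have h3 := h2.rpow_const (p := k) (Or.inl hpos.ne')
    have h4 := (((h1.pow (m - 1)).mul h3).const_mul (m * (x * y))).neg
    refine HasDerivAt.congr_deriv (f' := _) h4 ?_
    have : (1 - u ^ 2) ^ k = (1 - u ^ 2) * (1 - u ^ 2) ^ (k - 1) := by
      rw [Real.rpow_sub_one hpos.ne']; field_simp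
    simp only [Pi.pow_apply]
    rw [this]; ring
  · exact jw_int' k hk (fun u => (m * (x * y) * (2 * k * u * ((x + y) / 2 + u * (x - y) / 2) ^ (m - 1)
      - ((m - 1 : ℕ) : ℝ) * ((x + y) / 2 + u * (x - y) / 2) ^ (m - 1 - 1) * ((x - y) / 2)
        * (1 - u ^ 2)))) (by fun_prop)

theorem eigenfunction_equation_for_jack_integrand
    (k : ℝ) (hk : 0 < k) (m ℓ : ℕ)
    (f : ℝ → ℝ → ℝ)
    (hf : ∀ x₁ x₂ : ℝ, f x₁ x₂ =
      (x₁ * x₂) ^ ℓ *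
        ∫ u in (-1 : ℝ)..1, ((x₁ + x₂) / 2 + u * (x₁ - x₂) / 2) ^ m * (1 - u ^ 2) ^ (k - 1))
    (x₁ x₂ : ℝ) (hne : x₁ ≠ x₂) :
    Lam k f x₁ x₂ =
      (((m : ℝ) + ℓ) * ((m : ℝ) + ℓ + 2 * k - 1) + (ℓ : ℝ) * ((ℓ : ℝ) - 1)) * f x₁ x₂ := by
  let p : ℝ → ℝ := fun u => (1 + u) / 2
  let q : ℝ → ℝ := fun u => (1 - u) / 2
  have hp : Continuous p := by fun_prop
  have hq : Continuous q := by fun_prop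
  let J : ℕ → (ℝ → ℝ) → ℝ → ℝ → ℝ := fun n c s t =>
    ∫ u in (-1 : ℝ)..1, ((p u * s + q u * t) ^ n * c u) * (1 - u ^ 2) ^ (k - 1)
  have hJ1 : ∀ n c, Continuous c → ∀ s t, HasDerivAt (fun s => J n c s t)
      (J (n - 1) (fun u => n * p u * c u) s t) s := fun n c hc s t =>
    jw_deriv k hk n p (fun u => q u * t) c hp (by fun_prop) hc s
  have hJ2 : ∀ n c, Continuous c → ∀ s t, HasDerivAt (fun t => J n c s t)
      (J (n - 1) (fun u => n * q u * c u) s t) t := by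
    intro n c hc s t
    have := jw_deriv k hk n q (fun u => p u * s) c hq (by fun_prop) hc t
    simpa only [J, add_comm] using this
  have hfJ : ∀ s t, f s t = (s * t) ^ ℓ * J m (fun _ => 1) s t := by
    intro s t
    rw [hf]
    congr 1
    apply intervalIntegral.integral_congr
    intro u _
    simp only [p, q, mul_one]
    congr 2; ring
  obtain ⟨a1, a2⟩ := jw_prod ℓ x₂ x₁ (fun s => f s x₂) (fun s => J m (fun _ => 1) s x₂) _ _
    (fun s => hfJ s x₂) (fun s => hJ1 m _ continuous_const s x₂)
    (hJ1 (m - 1) (fun u => m * p u * 1) (by fun_prop) x₁ x₂)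
  obtain ⟨b1, b2⟩ := jw_prod ℓ x₁ x₂ (fun t => f x₁ t) (fun t => J m (fun _ => 1) x₁ t) _ _
    (fun t => by rw [hfJ, mul_comm x₁ t]) (fun t => hJ2 m _ continuous_const x₁ t)
    (hJ2 (m - 1) (fun u => m * q u * 1) (by fun_prop) x₁ x₂)
  rw [mul_comm x₂ x₁] at b1 b2
  have hI : ∀ n c, Continuous c → IntervalIntegrable (fun u =>
      ((p u * x₁ + q u * x₂) ^ n * c u) * (1 - u ^ 2) ^ (k - 1)) MeasureTheory.volume (-1) 1 :=
    fun n c hc => jw_int' k hk (fun u => (p u * x₁ + q u * x₂) ^ n * c u) (by fun_prop)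
  have euler : x₁ * J (m - 1) (fun u => m * p u * 1) x₁ x₂ +
      x₂ * J (m - 1) (fun u => m * q u * 1) x₁ x₂ = m * J m (fun _ => 1) x₁ x₂ := by
    simp only [J]
    rw [← intervalIntegral.integral_const_mul, ← intervalIntegral.integral_const_mul,
      ← intervalIntegral.integral_const_mul, ← intervalIntegral.integral_add
        ((hI _ _ (by fun_prop)).const_mul _) ((hI _ _ (by fun_prop)).const_mul _)]
    apply intervalIntegral.integral_congr
    intro u _
    rcases m with _ | n
    · simp
    · simp only [Nat.add_sub_cancel]; ring
  have main := jw_main k hk m x₁ x₂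
  have key : (x₁ - x₂) * x₁ ^ 2 *
        J (m - 1 - 1) (fun u => ((m - 1 : ℕ) : ℝ) * p u * (m * p u * 1)) x₁ x₂ +
      (x₁ - x₂) * x₂ ^ 2 *
        J (m - 1 - 1) (fun u => ((m - 1 : ℕ) : ℝ) * q u * (m * q u * 1)) x₁ x₂ +
      2 * k * x₁ ^ 2 * J (m - 1) (fun u => m * p u * 1) x₁ x₂ +
      (-(2 * k * x₂ ^ 2)) * J (m - 1) (fun u => m * q u * 1) x₁ x₂ =
      m * (m + 2 * k - 1) * (x₁ - x₂) * J m (fun _ => 1) x₁ x₂ := by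
    rw [← add_zero (_ * J m _ _ _), ← main]
    simp only [J]
    have i1 := (hI (m - 1 - 1) (fun u => ((m - 1 : ℕ) : ℝ) * p u * (m * p u * 1))
      (by fun_prop)).const_mul ((x₁ - x₂) * x₁ ^ 2)
    have i2 := (hI (m - 1 - 1) (fun u => ((m - 1 : ℕ) : ℝ) * q u * (m * q u * 1))
      (by fun_prop)).const_mul ((x₁ - x₂) * x₂ ^ 2)
    have i3 := (hI (m - 1) (fun u => m * p u * 1) (by fun_prop)).const_mul (2 * k * x₁ ^ 2)
    have i4 := (hI (m - 1) (fun u => m * q u * 1) (by fun_prop)).const_mul (-(2 * k * x₂ ^ 2))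
    have i5 := (hI m (fun _ => 1) (by fun_prop)).const_mul (m * (m + 2 * k - 1) * (x₁ - x₂))
    have i6 := jw_int' k hk (fun u => (m * (x₁ * x₂) *
      (2 * k * u * ((x₁ + x₂) / 2 + u * (x₁ - x₂) / 2) ^ (m - 1)
      - ((m - 1 : ℕ) : ℝ) * ((x₁ + x₂) / 2 + u * (x₁ - x₂) / 2) ^ (m - 1 - 1) * ((x₁ - x₂) / 2)
        * (1 - u ^ 2)))) (by fun_prop)
    simp only [← intervalIntegral.integral_const_mul]
    rw [← intervalIntegral.integral_add i1 i2, ← intervalIntegral.integral_add (i1.add i2) i3,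
      ← intervalIntegral.integral_add ((i1.add i2).add i3) i4,
      ← intervalIntegral.integral_add i5 i6]
    apply intervalIntegral.integral_congr
    intro u _
    have hX : (x₁ + x₂) / 2 + u * (x₁ - x₂) / 2 = p u * x₁ + q u * x₂ := by
      simp only [p, q]; ring
    simp only [hX]
    rcases m with _ | _ | n
    · simp
    · simp [p, q]; ring
    · simp only [Nat.add_sub_cancel]
      push_cast
      rw [pow_succ _ (n + 1), pow_succ _ n]
      generalize (p u * x₁ + q u * x₂) ^ n = Z
      generalize (1 - u ^ 2) ^ (k - 1) = W
      simp only [p, q]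
      ring
  have hd : x₁ - x₂ ≠ 0 := sub_ne_zero.mpr hne
  have hd' : x₂ - x₁ ≠ 0 := sub_ne_zero.mpr hne.symm
  have hL : (x₁ - x₂) * Lam k f x₁ x₂ =
      (x₁ - x₂) * (x₁ ^ 2 * deriv (deriv (fun s => f s x₂)) x₁) +
      (x₁ - x₂) * (x₂ ^ 2 * deriv (deriv (fun s => f x₁ s)) x₂) +
      2 * k * (x₁ * (x₁ * deriv (fun s => f s x₂) x₁)
        - x₂ * (x₂ * deriv (fun s => f x₁ s) x₂)) := by
    unfold Lam
    rw [← neg_sub x₁ x₂, div_neg]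
    field_simp
    ring
  apply mul_left_cancel₀ hd
  rw [hL, a1, a2, b1, b2, hfJ]
  linear_combination (x₁ * x₂) ^ ℓ * key + (x₁ * x₂) ^ ℓ * (x₁ - x₂) * 2 * ℓ * euler
end

section
/- (Product formula for two-variable Jack polynomials.) Let k > 0 and m,ℓ ≥ 0 integers. For all x = (x₁,x₂) and y = (y₁,y₂) with x₁,x₂,y₁,y₂ ≥ 0, P_{m,ℓ}(x₁,x₂) P_{m,ℓ}(y₁,y₂) / P_{m,ℓ}(1,1) = (Γ(k+1/2)/(Γ(k)√π)) ∫_{−1}^{1} P_{m,ℓ}(X₁(x,y,u), X₂(x,y,u)) (1−u²)^{k−1} du. -/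
open Real

section JackAux
open Polynomial

/-- moment expansion -/
noncomputable def jG (M : ℕ → ℝ) (n : ℕ) (s d : ℝ) : ℝ :=
  ∑ i ∈ Finset.range (n + 1), (n.choose i : ℝ) * M i * s ^ (n - i) * d ^ i

noncomputable def jT (k a : ℝ) (f : ℝ[X]) : ℝ[X] :=
  C (a * (a - 1)) * (X * f) - C (2 * (a - 1)) * (X ^ 2 * derivative f)
    + (X ^ 3 - X) * derivative (derivative f) - C (2 * k) * derivative f

noncomputable def jE (M : ℕ → ℝ) (t e : ℝ) (n : ℕ) : ℝ[X] :=
  ∑ i ∈ Finset.range (n + 1), C ((n.choose i : ℝ) * M i * t ^ (n - i) * e ^ i) * X ^ i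

noncomputable def jq (k : ℝ) (m : ℕ) : ℕ → ℝ
  | 0 => 1
  | j + 1 => - jq k m j * ((m - 2 * j) * (m - 2 * j - 1)) / (4 * (j + 1) * (k + m - j - 1))

lemma jT_add (k a : ℝ) (f g : ℝ[X]) : jT k a (f + g) = jT k a f + jT k a g := by
  simp only [jT, derivative_add]; ring

lemma jT_C (k a c : ℝ) (f : ℝ[X]) : jT k a (C c * f) = C c * jT k a f := by
  simp only [jT, derivative_C_mul]; ring

lemma jT_rho (k a : ℝ) (f : ℝ[X]) :
    jT k (a + 2) ((1 - X ^ 2) * f) = (1 - X ^ 2) * jT k a f + C (4 * (k + 1 + a)) * (X * f) := by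
  simp only [jT, derivative_mul, derivative_sub, derivative_one, derivative_X_pow, derivative_add,
    map_mul, map_add, map_sub, map_one, map_ofNat, map_natCast, derivative_X, derivative_natCast,
    derivative_zero, derivative_ofNat]
  norm_num
  ring

lemma jT_rho_pow (k a : ℝ) (f : ℝ[X]) (j : ℕ) :
    jT k (a + 2 * (j + 1 : ℕ)) ((1 - X ^ 2) ^ (j + 1) * f) = (1 - X ^ 2) ^ (j + 1) * jT k a f
      + C (4 * (j + 1) * (k + (j + 1) + a)) * (X * ((1 - X ^ 2) ^ j * f)) := by
  induction j with
  | zero => 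
    have := jT_rho k a f
    simp only [zero_add, pow_one, Nat.cast_one, mul_one, pow_zero, Nat.cast_zero, one_mul]
    exact this
  | succ j ih =>
    rw [pow_succ' _ (j + 1), mul_assoc]
    have : a + 2 * ((j + 1 + 1 : ℕ) : ℝ) = (a + 2 * (j + 1 : ℕ)) + 2 := by push_cast; ring
    rw [this, jT_rho, ih]
    simp only [map_mul, map_add, map_one, map_ofNat, map_natCast]
    push_cast
    ring

lemma jE_coeff (M : ℕ → ℝ) (t e : ℝ) (n i : ℕ) :
    (jE M t e n).coeff i = (n.choose i : ℝ) * M i * t ^ (n - i) * e ^ i := by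
  simp only [jE, finsetSum_coeff, coeff_C_mul_X_pow]
  rw [Finset.sum_ite_eq]
  split_ifs with h
  · rfl
  · rw [Nat.choose_eq_zero_of_lt (by simpa using h)]; simp

lemma jT_coeff_zero (k a : ℝ) (f : ℝ[X]) : (jT k a f).coeff 0 = - (2 * k) * f.coeff 1 := by
  simp [jT, coeff_derivative, mul_coeff_zero]

lemma jT_coeff_succ (k a : ℝ) (f : ℝ[X]) (i : ℕ) : (jT k a f).coeff (i + 1) =
    (a - i) * (a - i - 1) * f.coeff i - (i + 2) * (i + 1 + 2 * k) * f.coeff (i + 2) := by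
  have h : jT k a f = C (a * (a - 1)) * (f * X) - C (2 * (a - 1)) * ((derivative f * X) * X)
    + (((derivative (derivative f) * X) * X) * X - derivative (derivative f) * X)
      - C (2 * k) * derivative f := by simp only [jT]; ring
  rw [h]
  simp only [coeff_sub, coeff_add, coeff_C_mul, coeff_mul_X]
  rcases i with _ | _ | i
  · simp [coeff_derivative]; ring
  · simp [coeff_derivative, coeff_mul_X]; ring
  · simp only [coeff_mul_X, coeff_derivative]; push_cast; ring

lemma jchoose (n i : ℕ) : ((n + 2).choose i : ℝ) * ((n + 2 - i) * (n + 1 - i)) =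
    (n + 2) * (n + 1) * n.choose i := by
  rcases le_or_gt i n with h | h
  · have h1 := Nat.choose_mul_succ_eq n i
    have h2 := Nat.choose_mul_succ_eq (n + 1) i
    have h1' : (n.choose i : ℝ) * (n + 1) = (n + 1).choose i * (n + 1 - i) := by
      have := congrArg (Nat.cast : ℕ → ℝ) h1
      push_cast [Nat.cast_sub (show i ≤ n + 1 by omega)] at this
      linarith
    have h2' : ((n + 1).choose i : ℝ) * (n + 2) = (n + 2).choose i * (n + 2 - i) := by
      have := congrArg (Nat.cast : ℕ → ℝ) h2
      push_cast [Nat.cast_sub (show i ≤ n + 1 + 1 by omega)] at this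
      linarith
    linear_combination (-(n + 2 : ℝ)) * h1' - (n + 1 - i : ℝ) * h2'
  · rw [Nat.choose_eq_zero_of_lt h]
    rcases (show i = n + 1 ∨ i = n + 2 ∨ n + 2 < i by omega) with rfl | rfl | h
    · push_cast; ring
    · push_cast; ring
    · rw [Nat.choose_eq_zero_of_lt h]; simp

lemma jchoose2 (n i : ℕ) : ((n + 2).choose (i + 2) : ℝ) * ((i + 2) * (i + 1)) =
    (n + 2) * (n + 1) * n.choose i := by
  have h1 : ((n : ℝ) + 1) * n.choose i = (n + 1).choose (i + 1) * (i + 1) := by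
    exact_mod_cast Nat.add_one_mul_choose_eq n i
  have h2 : ((n : ℝ) + 1 + 1) * (n + 1).choose (i + 1) = (n + 2).choose (i + 2) * (i + 1 + 1) := by
    exact_mod_cast Nat.add_one_mul_choose_eq (n + 1) (i + 1)
  linear_combination (-(n + 2 : ℝ)) * h1 - (i + 1 : ℝ) * h2

lemma jT_E (k t e : ℝ) (M : ℕ → ℝ) (h1 : M 1 = 0)
    (hM : ∀ i : ℕ, (2 * k + i + 1) * M (i + 2) = (i + 1) * M i) (n : ℕ) :
    jT k (n + 2 : ℕ) (jE M t e (n + 2)) =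
      C ((t ^ 2 - e ^ 2) * ((n + 2) * (n + 1))) * (X * jE M t e n) := by
  ext i
  rcases i with _ | i
  · rw [jT_coeff_zero, jE_coeff, h1]; simp
  · rw [jT_coeff_succ, coeff_C_mul, mul_comm X, coeff_mul_X, jE_coeff, jE_coeff, jE_coeff]
    have c1 := jchoose n i
    have c2 := jchoose2 n i
    have hm := hM i
    have hi : (i : ℝ) + 1 ≠ 0 := by positivity
    have e2 : n + 2 - (i + 2) = n - i := by omega
    rw [e2]
    rcases le_or_gt i n with h | h
    · have e1 : n + 2 - i = (n - i) + 2 := by omega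
      rw [e1]
      push_cast
      have A : ((n + 2).choose (i + 2) : ℝ) * (i + 2) * ((2 * k + i + 1) * M (i + 2)) = 
        (n + 2) * (n + 1) * n.choose i * M i := by
        rw [hm, ← c2]; ring
      linear_combination (M i * t ^ (n - i) * t ^ 2 * e ^ i) * c1 - (t ^ (n - i) * e ^ i * e ^ 2) * A
    · rw [Nat.choose_eq_zero_of_lt h, Nat.choose_eq_zero_of_lt (show n + 2 < i + 2 by omega)]
      rw [Nat.choose_eq_zero_of_lt h] at c1
      push_cast at *
      linear_combination (M i * t ^ (n + 2 - i) * e ^ i) * c1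

lemma jT_E0 (k t e : ℝ) (M : ℕ → ℝ) : jT k (0 : ℕ) (jE M t e 0) = 0 := by
  simp [jE, jT]

lemma jT_E1 (k t e : ℝ) (M : ℕ → ℝ) (h1 : M 1 = 0) : jT k (1 : ℕ) (jE M t e 1) = 0 := by
  simp [jE, jT, Finset.sum_range_succ, h1]

lemma jT_sum (k : ℝ) (hk : 0 < k) (t e : ℝ) (M : ℕ → ℝ) (h1 : M 1 = 0)
    (hM : ∀ i : ℕ, (2 * k + i + 1) * M (i + 2) = (i + 1) * M i) (m N n : ℕ) (h : m = n + 2 * N) :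
    jT k m (∑ j ∈ Finset.range (N + 1),
      C (jq k m j * (t ^ 2 - e ^ 2) ^ j) * ((1 - X ^ 2) ^ j * jE M t e (m - 2 * j))) =
    C (jq k m N * (t ^ 2 - e ^ 2) ^ N) * ((1 - X ^ 2) ^ N * jT k n (jE M t e n)) := by
  induction N generalizing n with
  | zero => subst h; simp [jT_C, jq]
  | succ N ih =>
    rw [Finset.sum_range_succ, jT_add, ih (n + 2) (by omega), jT_E k t e M h1 hM, jT_C]
    have e1 : m - 2 * (N + 1) = n := by omega
    have e2 : (m : ℝ) = n + 2 * (N + 1 : ℕ) := by rw [h]; push_cast; ring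
    rw [e1]
    have := jT_rho_pow k n (jE M t e n) N
    rw [← e2] at this
    rw [this]
    have hq : jq k m (N + 1) * (4 * (N + 1) * (k + (N + 1) + n)) = 
        - jq k m N * ((n + 2) * (n + 1)) := by
      rw [jq]
      have : k + m - N - 1 = k + (N + 1) + n := by rw [e2]; push_cast; ring
      rw [this, div_mul_cancel₀ _ (by positivity), e2]
      push_cast; ring
    have hq' := congrArg (C : ℝ → ℝ[X]) hq
    simp only [map_mul, map_neg, map_pow] at hq' ⊢
    linear_combination (C (t ^ 2 - e ^ 2) ^ (N + 1) * (X * ((1 - X ^ 2) ^ N * jE M t e n))) * hq'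

/-- uniqueness -/
lemma jT_unique (k : ℝ) (hk : 0 < k) (a : ℝ) (f : ℝ[X]) (hf : jT k a f = 0) (h0 : f.coeff 0 = 0) :
    f = 0 := by
  have key : ∀ i, f.coeff i = 0 ∧ f.coeff (i + 1) = 0 := by
    intro i
    induction i with
    | zero =>
      refine ⟨h0, ?_⟩
      have := jT_coeff_zero k a f
      rw [hf, coeff_zero] at this
      have : 2 * k * f.coeff 1 = 0 := by linarith
      rcases mul_eq_zero.1 this with h | h
      · exact absurd h (by positivity)
      · exact h
    | succ i ih =>
      refine ⟨ih.2, ?_⟩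
      have := jT_coeff_succ k a f i
      rw [hf, coeff_zero, ih.1] at this
      have : ((i : ℝ) + 2) * (i + 1 + 2 * k) * f.coeff (i + 2) = 0 := by linarith
      rcases mul_eq_zero.1 this with h | h
      · exact absurd h (by positivity)
      · exact h
  ext i
  simp [(key i).1]

lemma jE_eval (M : ℕ → ℝ) (t e d : ℝ) (n : ℕ) : (jE M t e n).eval d = jG M n t (d * e) := by
  simp only [jE, jG, eval_finsetSum, eval_mul, eval_C, eval_pow, eval_X]
  refine Finset.sum_congr rfl fun i _ => ?_
  rw [mul_pow]; ring

lemma jG_homog (M : ℕ → ℝ) (n : ℕ) (c s d : ℝ) : jG M n (c * s) (c * d) = c ^ n * jG M n s d := by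
  simp only [jG, Finset.mul_sum]
  refine Finset.sum_congr rfl fun i hi => ?_
  have : n = (n - i) + i := by have := Finset.mem_range.1 hi; omega
  rw [mul_pow, mul_pow]
  conv_rhs => rw [show c ^ n = c ^ (n - i) * c ^ i by rw [← pow_add, ← this]]
  ring

lemma jG_zero (M : ℕ → ℝ) (h0 : M 0 = 1) (n : ℕ) (s : ℝ) : jG M n s 0 = s ^ n := by
  rw [jG, Finset.sum_eq_single 0]
  · simp [h0]
  · intro i _ hi; simp [hi]
  · simp

noncomputable def jR (k : ℝ) (M : ℕ → ℝ) (m : ℕ) (s d t e : ℝ) : ℝ :=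
  ∑ j ∈ Finset.range (m / 2 + 1),
    jq k m j * ((s ^ 2 - d ^ 2) * (t ^ 2 - e ^ 2)) ^ j * jG M (m - 2 * j) (s * t) (d * e)

lemma jR_one (k : ℝ) (hk : 0 < k) (t e : ℝ) (M : ℕ → ℝ) (h0 : M 0 = 1) (h1 : M 1 = 0)
    (hM : ∀ i : ℕ, (2 * k + i + 1) * M (i + 2) = (i + 1) * M i) (m : ℕ) (d : ℝ) :
    jR k M m 1 d t e = jR k M m 1 0 t e * jG M m 1 d := by
  set f := ∑ j ∈ Finset.range (m / 2 + 1),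
      C (jq k m j * (t ^ 2 - e ^ 2) ^ j) * ((1 - X ^ 2) ^ j * jE M t e (m - 2 * j)) with hf
  have hev : ∀ d, f.eval d = jR k M m 1 d t e := by
    intro d
    simp only [hf, jR, eval_finsetSum, eval_mul, eval_C, eval_pow, eval_X, jE_eval, eval_sub,
      eval_one]
    refine Finset.sum_congr rfl fun i _ => ?_
    rw [mul_pow]; ring_nf
  have hTE : ∀ t e, jT k (m % 2 : ℕ) (jE M t e (m % 2)) = 0 := by
    intro t e
    rcases Nat.mod_two_eq_zero_or_one m with h | h
    · rw [h]; exact jT_E0 k t e M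
    · rw [h]; exact jT_E1 k t e M h1
  have hTf : jT k m f = 0 := by
    rw [hf, jT_sum k hk t e M h1 hM m (m / 2) (m % 2) (by omega), hTE]; simp
  have hTg : jT k m (jE M 1 1 m) = 0 := by
    rcases Nat.lt_or_ge m 2 with h | h
    · have := hTE 1 1; rwa [Nat.mod_eq_of_lt h] at this
    · obtain ⟨n, rfl⟩ := Nat.exists_eq_add_of_le' h
      rw [jT_E k 1 1 M h1 hM]; simp
  have hz : f + C (- jR k M m 1 0 t e) * jE M 1 1 m = 0 := by
    apply jT_unique k hk m
    · rw [jT_add, jT_C, hTf, hTg]; simp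
    · rw [coeff_add, coeff_C_mul, jE_coeff, coeff_zero_eq_eval_zero, hev]; simp [h0]
  have := congrArg (eval d) hz
  rw [eval_add, eval_mul, eval_C, hev, jE_eval, eval_zero, mul_one] at this
  linarith

lemma jG_cont (M : ℕ → ℝ) (n : ℕ) : Continuous fun p : ℝ × ℝ => jG M n p.1 p.2 := by
  unfold jG; fun_prop

lemma jR_homog (k : ℝ) (M : ℕ → ℝ) (m : ℕ) (c s d t e : ℝ) :
    jR k M m (c * s) (c * d) t e = c ^ m * jR k M m s d t e := by
  simp only [jR, Finset.mul_sum]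
  refine Finset.sum_congr rfl fun j hj => ?_
  have : m = (m - 2 * j) + 2 * j := by have := Finset.mem_range.1 hj; omega
  rw [mul_assoc c s, mul_assoc c d, jG_homog]
  conv_rhs => rw [show c ^ m = c ^ (m - 2 * j) * (c ^ 2) ^ j by rw [← pow_mul, ← pow_add, ← this]]
  rw [show ((c * s) ^ 2 - (c * d) ^ 2) * (t ^ 2 - e ^ 2) = 
    c ^ 2 * ((s ^ 2 - d ^ 2) * (t ^ 2 - e ^ 2)) by ring, mul_pow (c ^ 2)]
  ring

lemma jR_main (k : ℝ) (hk : 0 < k) (t e : ℝ) (M : ℕ → ℝ) (h0 : M 0 = 1) (h1 : M 1 = 0)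
    (hM : ∀ i : ℕ, (2 * k + i + 1) * M (i + 2) = (i + 1) * M i) (m : ℕ) (s d : ℝ) :
    jR k M m s d t e = jR k M m 1 0 t e * jG M m s d := by
  have hcR : Continuous fun s => jR k M m s d t e := by
    unfold jR jG; fun_prop
  have hcG : Continuous fun s => jR k M m 1 0 t e * jG M m s d := by
    unfold jG; fun_prop
  have := Continuous.ext_on (dense_compl_singleton (0 : ℝ)) hcR hcG (by
    intro s hs
    have hs : s ≠ 0 := hs
    have a := jR_homog k M m s 1 (d / s) t e
    have b := jG_homog M m s 1 (d / s)
    rw [mul_one, mul_div_cancel₀ _ hs] at a b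
    simp only [a, b, jR_one k hk t e M h0 h1 hM m (d / s)]
    ring)
  exact congrFun this s

lemma jR_symm (k : ℝ) (M : ℕ → ℝ) (m : ℕ) (s d t e : ℝ) : jR k M m s d t e = jR k M m t e s d := by
  simp only [jR, mul_comm s t, mul_comm d e, mul_comm (s ^ 2 - d ^ 2)]

lemma jR_final (k : ℝ) (hk : 0 < k) (t e : ℝ) (M : ℕ → ℝ) (h0 : M 0 = 1) (h1 : M 1 = 0)
    (hM : ∀ i : ℕ, (2 * k + i + 1) * M (i + 2) = (i + 1) * M i) (m : ℕ) (s d : ℝ) :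
    jR k M m s d t e = jR k M m 1 0 1 0 * jG M m t e * jG M m s d := by
  rw [jR_main k hk t e M h0 h1 hM, jR_symm k M m 1 0 t e, jR_main k hk 1 0 M h0 h1 hM m t e]

lemma jR_ne (k : ℝ) (hk : 0 < k) (M : ℕ → ℝ) (h0 : M 0 = 1) (h1 : M 1 = 0)
    (hM : ∀ i : ℕ, (2 * k + i + 1) * M (i + 2) = (i + 1) * M i) (m : ℕ) :
    jR k M m 1 0 1 0 ≠ 0 := by
  intro h
  have := jR_final k hk 1 0 M h0 h1 hM m 1 1
  rw [h, zero_mul, zero_mul, jR, Finset.sum_eq_single 0] at this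
  · simp [jq, jG_zero M h0] at this
  · intro i _ hi; simp [hi]
  · simp

end JackAux

section JackInt
open MeasureTheory intervalIntegral

noncomputable def jw (k u : ℝ) : ℝ := (1 - u ^ 2) ^ (k - 1)

noncomputable def jW (k : ℝ) (i : ℕ) : ℝ := ∫ u in (-1 : ℝ)..1, u ^ i * jw k u

lemma jbeta (k : ℝ) : ∀ x ∈ Set.uIcc (0 : ℝ) 1,
    (x : ℂ) ^ ((k : ℂ) - 1) * (1 - (x : ℂ)) ^ ((k : ℂ) - 1) =
      (((4 : ℝ) ^ (1 - k) * jw k (2 * x - 1) : ℝ) : ℂ) := by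
  intro x hx
  rw [Set.uIcc_of_le zero_le_one] at hx
  have h1 : 0 ≤ 1 - x := by linarith [hx.2]
  have : jw k (2 * x - 1) = 4 ^ (k - 1) * (x ^ (k - 1) * (1 - x) ^ (k - 1)) := by
    rw [jw, show 1 - (2 * x - 1) ^ 2 = 4 * (x * (1 - x)) by ring, mul_rpow (by norm_num)
      (mul_nonneg hx.1 h1), mul_rpow hx.1 h1]
  rw [this, ← mul_assoc, ← rpow_add (by norm_num), show 1 - k + (k - 1) = 0 by ring, rpow_zero, one_mul,
    Complex.ofReal_mul, Complex.ofReal_cpow hx.1, Complex.ofReal_cpow h1]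
  push_cast
  rfl

lemma jw_int_s12 (k : ℝ) (hk : 0 < k) : IntervalIntegrable (jw k) volume (-1) 1 := by
  have h := Complex.betaIntegral_convergent (u := k) (v := k) (by simpa using hk) (by simpa using hk)
  have h2 : IntervalIntegrable (fun x : ℝ => (((4 : ℝ) ^ (1 - k) * jw k (2 * x - 1) : ℝ) : ℂ)) volume 0 1 :=
    h.congr (fun x hx => jbeta k x (Set.uIoc_subset_uIcc hx))
  have h3 : IntervalIntegrable (fun x : ℝ => (4 : ℝ) ^ (1 - k) * jw k (2 * x - 1)) volume 0 1 := by
    rw [intervalIntegrable_iff] at h2 ⊢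
    have := h2.re
    simp only [RCLike.re_to_complex, Complex.ofReal_re] at this
    exact this
  have h4 : IntervalIntegrable (fun x : ℝ => jw k (2 * x - 1)) volume 0 1 := by
    have := h3.const_mul ((4 : ℝ) ^ (k - 1))
    refine this.congr (fun x _ => ?_)
    show (4 : ℝ) ^ (k - 1) * (4 ^ (1 - k) * jw k (2 * x - 1)) = _
    rw [← mul_assoc, ← rpow_add (by norm_num)]; simp
  have h5 := h4.comp_mul_left (c := 1 / 2)
  have h6 := h5.comp_add_right 1
  norm_num at h6
  refine h6.congr (fun x _ => ?_)
  show jw k _ = jw k x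
  congr 1; ring

lemma jW_zero (k : ℝ) (hk : 0 < k) : jW k 0 = Real.Gamma k * √π / Real.Gamma (k + 1 / 2) := by
  have h := Complex.betaIntegral_eq_Gamma_mul_div k k (by simpa using hk) (by simpa using hk)
  rw [Complex.betaIntegral, intervalIntegral.integral_congr (jbeta k), intervalIntegral.integral_ofReal,
    ← Complex.ofReal_add, Complex.Gamma_ofReal, Complex.Gamma_ofReal] at h
  have h' : ∫ x in (0 : ℝ)..1, (4 : ℝ) ^ (1 - k) * jw k (2 * x - 1) =
    Real.Gamma k * Real.Gamma k / Real.Gamma (k + k) := by exact_mod_cast h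
  rw [intervalIntegral.integral_const_mul, intervalIntegral.integral_comp_mul_sub _ (by norm_num)] at h'
  have e0 : jW k 0 = ∫ u in (-1 : ℝ)..1, jw k u := by simp [jW]
  norm_num at h'
  rw [← e0] at h'
  have hd := Real.Gamma_mul_Gamma_add_half k
  have hg := Real.Gamma_pos_of_pos hk
  have hg2 := Real.Gamma_pos_of_pos (show 0 < k + 1 / 2 by linarith)
  have hg3 := Real.Gamma_pos_of_pos (show 0 < k + k by linarith)
  have e4 : (4 : ℝ) ^ (1 - k) = 2 * 2 ^ (1 - 2 * k) := by
    rw [show (4 : ℝ) = 2 ^ (2 : ℝ) by norm_num, ← rpow_mul (by norm_num),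
      show (2 : ℝ) * (1 - k) = 1 + (1 - 2 * k) by ring, rpow_add (by norm_num), rpow_one]
  rw [e4] at h'
  rw [← two_mul] at h' hg3
  have hp : (0 : ℝ) < 2 ^ (1 - 2 * k) := by positivity
  rw [eq_div_iff hg2.ne']
  rw [eq_div_iff hg3.ne'] at h'
  have : (Real.Gamma k * 2 ^ (1 - 2 * k) * Real.Gamma (2 * k)) * (jW k 0 * Real.Gamma (k + 1 / 2)) =
    (Real.Gamma k * 2 ^ (1 - 2 * k) * Real.Gamma (2 * k)) * (Real.Gamma k * √π) := by
    linear_combination (Real.Gamma k * Real.Gamma (k + 1 / 2)) * h' + Real.Gamma k ^ 2 * hd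
  exact mul_left_cancel₀ (by positivity) this

lemma jwc_int (k : ℝ) (hk : 0 < k) {f : ℝ → ℝ} (hf : Continuous f) :
    IntervalIntegrable (fun u => f u * jw k u) volume (-1) 1 :=
  (jw_int_s12 k hk).continuousOn_mul hf.continuousOn

lemma jparts (k : ℝ) (hk : 0 < k) (i : ℕ) :
    ∫ u in (-1 : ℝ)..1, (i * u ^ (i - 1) * (1 - u ^ 2) - 2 * k * u ^ (i + 1)) * jw k u = 0 := by
  have := integral_eq_sub_of_hasDerivAt_of_le (a := -1) (b := 1)
    (f := fun u : ℝ => u ^ i * (1 - u ^ 2) ^ k)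
    (f' := fun u => (i * u ^ (i - 1) * (1 - u ^ 2) - 2 * k * u ^ (i + 1)) * jw k u) (by norm_num)
    (by
      apply Continuous.continuousOn
      exact (continuous_pow i).mul ((by fun_prop : Continuous fun u : ℝ => 1 - u ^ 2).rpow_const
        (fun _ => Or.inr hk.le)))
    (by
      intro u hu
      have hp : 0 < 1 - u ^ 2 := by nlinarith [hu.1, hu.2]
      have h1 : HasDerivAt (fun u : ℝ => 1 - u ^ 2) (-(2 * u)) u := by
        simpa using (hasDerivAt_pow 2 u).const_sub 1
      have h2 := (hasDerivAt_pow i u).mul (h1.rpow_const (p := k) (Or.inl hp.ne'))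
      refine h2.congr_deriv ?_
      have : (1 - u ^ 2) ^ k = (1 - u ^ 2) * jw k u := by
        rw [jw, rpow_sub_one hp.ne']; field_simp
      rw [this, pow_succ]; simp only [jw]; ring)
    (jwc_int k hk (by fun_prop))
  rw [this]
  norm_num [hk.ne']

lemma jW_one (k : ℝ) (hk : 0 < k) : jW k 1 = 0 := by
  have := jparts k hk 0
  have h : ∫ u in (-1 : ℝ)..1, ((0 : ℕ) * u ^ (0 - 1) * (1 - u ^ 2) - 2 * k * u ^ (0 + 1)) * jw k u
    = (-(2 * k)) * jW k 1 := by
    rw [jW, ← intervalIntegral.integral_const_mul]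
    congr 1; ext u; simp; ring
  rw [h] at this
  rcases mul_eq_zero.1 this with h | h
  · linarith
  · exact h

lemma jW_rec (k : ℝ) (hk : 0 < k) (i : ℕ) : (2 * k + i + 1) * jW k (i + 2) = (i + 1) * jW k i := by
  have := jparts k hk (i + 1)
  have h : ∫ u in (-1 : ℝ)..1, ((i + 1 : ℕ) * u ^ (i + 1 - 1) * (1 - u ^ 2)
      - 2 * k * u ^ (i + 1 + 1)) * jw k u
    = (i + 1) * jW k i - (2 * k + i + 1) * jW k (i + 2) := by
    rw [jW, jW, ← intervalIntegral.integral_const_mul, ← intervalIntegral.integral_const_mul,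
      ← intervalIntegral.integral_sub]
    · congr 1; ext u; simp; ring
    · exact (jwc_int k hk (by fun_prop)).const_mul _
    · exact (jwc_int k hk (by fun_prop)).const_mul _
  rw [h] at this
  linarith

lemma jint_pow (k : ℝ) (hk : 0 < k) (n : ℕ) (s d : ℝ) :
    ∫ u in (-1 : ℝ)..1, (s + u * d) ^ n * jw k u = jG (jW k) n s d := by
  have h : ∀ u : ℝ, (s + u * d) ^ n * jw k u = ∑ i ∈ Finset.range (n + 1),
      ((n.choose i : ℝ) * s ^ (n - i) * d ^ i) * (u ^ i * jw k u) := by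
    intro u
    rw [add_comm, add_pow, Finset.sum_mul]
    refine Finset.sum_congr rfl fun i _ => ?_
    rw [mul_pow]; ring
  simp_rw [h]
  rw [intervalIntegral.integral_finsetSum]
  · simp_rw [intervalIntegral.integral_const_mul]
    rw [jG]
    refine Finset.sum_congr rfl fun i _ => ?_
    rw [jW]; ring
  · intro i _
    exact (jwc_int k hk (by fun_prop)).const_mul _

lemma jG_scale (M : ℕ → ℝ) (c : ℝ) (n : ℕ) (s d : ℝ) :
    jG (fun i => c * M i) n s d = c * jG M n s d := by
  simp only [jG, Finset.mul_sum]
  refine Finset.sum_congr rfl fun i _ => ?_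
  ring

lemma jprod (k : ℝ) (hk : 0 < k) (m : ℕ) (s d t e : ℝ) (D : ℝ → ℝ)
    (hD : ∀ u ∈ Set.uIcc (-1 : ℝ) 1, D u ^ 2 = (s * t + u * (d * e)) ^ 2 - (s ^ 2 - d ^ 2) * (t ^ 2 - e ^ 2)) :
    ∫ u in (-1 : ℝ)..1, jG (jW k) m (s * t + u * (d * e)) (D u) * jw k u =
      jG (jW k) m s d * jG (jW k) m t e := by
  have hW : 0 < jW k 0 := by
    rw [jW_zero k hk]
    have := Real.Gamma_pos_of_pos hk
    have := Real.Gamma_pos_of_pos (show 0 < k + 1 / 2 by linarith)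
    positivity
  set M : ℕ → ℝ := fun i => jW k i / jW k 0 with hMd
  have h0 : M 0 = 1 := div_self hW.ne'
  have h1 : M 1 = 0 := by simp [hMd, jW_one k hk]
  have hM : ∀ i : ℕ, (2 * k + i + 1) * M (i + 2) = (i + 1) * M i := by
    intro i
    simp only [hMd]
    rw [mul_div_assoc', mul_div_assoc', jW_rec k hk]
  have hWM : jW k = fun i => jW k 0 * M i := by
    ext i; simp only [hMd]; field_simp
  have hGM : ∀ n s d, jG (jW k) n s d = jW k 0 * jG M n s d := by
    intro n s d
    rw [hWM, jG_scale]; simp [h0]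
  have hQ := jR_ne k hk M h0 h1 hM m
  set Q := jR k M m 1 0 1 0 with hQd
  have step : ∀ u ∈ Set.uIcc (-1 : ℝ) 1, jG (jW k) m (s * t + u * (d * e)) (D u) * jw k u =
      ∑ j ∈ Finset.range (m / 2 + 1), (jW k 0 / Q * (jq k m j * ((s ^ 2 - d ^ 2) * (t ^ 2 - e ^ 2)) ^ j)) *
        ((s * t + u * (d * e)) ^ (m - 2 * j) * jw k u) := by
    intro u hu
    have := jR_final k hk 1 0 M h0 h1 hM m (s * t + u * (d * e)) (D u)
    rw [← hQd, jG_zero M h0, one_pow, mul_one] at this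
    rw [hGM]
    have h3 : jG M m (s * t + u * (d * e)) (D u) =
      jR k M m (s * t + u * (d * e)) (D u) 1 0 / Q := by rw [this]; field_simp
    rw [h3, jR, hD u hu, Finset.sum_div, Finset.mul_sum, Finset.sum_mul]
    refine Finset.sum_congr rfl fun j _ => ?_
    rw [mul_zero, jG_zero M h0]
    ring_nf
  rw [intervalIntegral.integral_congr step, intervalIntegral.integral_finsetSum]
  · simp_rw [intervalIntegral.integral_const_mul, jint_pow k hk, hGM]
    have := jR_final k hk t e M h0 h1 hM m s d
    rw [← hQd, jR] at this
    have h2 : ∀ S : ℝ, S = Q * jG M m t e * jG M m s d → 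
      jW k 0 * jW k 0 / Q * S = jW k 0 * jG M m s d * (jW k 0 * jG M m t e) := by
      intro S hS; rw [hS]; field_simp
    rw [← h2 _ this, Finset.mul_sum]
    refine Finset.sum_congr rfl fun j _ => ?_
    ring
  · intro j _
    exact (jwc_int k hk (by fun_prop)).const_mul _

lemma jackP_eq (k : ℝ) (hk : 0 < k) (m ℓ : ℕ) (x₁ x₂ : ℝ) : JackP k m ℓ x₁ x₂ =
    (Real.Gamma (m + 2 * k) / ((2 : ℝ) ^ (2 * k - 1) * Real.Gamma k * Real.Gamma (m + k))) *
    ((x₁ * x₂) ^ ℓ * jG (jW k) m ((x₁ + x₂) / 2) ((x₁ - x₂) / 2)) := by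
  rw [JackP, ← jint_pow k hk]
  simp only [jw, mul_div_assoc]

end JackInt

/-- Product formula for two-variable Jack polynomials (Theorem 1). -/
theorem jack_product_formula
    (k : ℝ) (hk : 0 < k) (m ℓ : ℕ)
    (x₁ x₂ y₁ y₂ : ℝ) (hx₁ : 0 ≤ x₁) (hx₂ : 0 ≤ x₂) (hy₁ : 0 ≤ y₁) (hy₂ : 0 ≤ y₂) :
    JackP k m ℓ x₁ x₂ * JackP k m ℓ y₁ y₂ / JackP k m ℓ 1 1 =
      (Real.Gamma (k + 1 / 2) / (Real.Gamma k * Real.sqrt Real.pi)) *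
        ∫ u in (-1 : ℝ)..1,
          JackP k m ℓ (X1 x₁ x₂ y₁ y₂ u) (X2 x₁ x₂ y₁ y₂ u) * (1 - u ^ 2) ^ (k - 1) := by
  set c := Real.Gamma (m + 2 * k) / ((2 : ℝ) ^ (2 * k - 1) * Real.Gamma k * Real.Gamma (m + k)) with hc
  have hg := Real.Gamma_pos_of_pos hk
  have hg2 := Real.Gamma_pos_of_pos (show 0 < k + 1 / 2 by linarith)
  have hg3 := Real.Gamma_pos_of_pos (show 0 < m + k by positivity)
  have hg4 := Real.Gamma_pos_of_pos (show 0 < m + 2 * k by positivity)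
  have hc0 : 0 < c := by rw [hc]; positivity
  have hpi : 0 < √π := Real.sqrt_pos.2 Real.pi_pos
  have hW := jW_zero k hk
  have hW0 : 0 < jW k 0 := by rw [hW]; positivity
  have h11 : JackP k m ℓ 1 1 = c * jW k 0 := by
    rw [jackP_eq k hk, ← hc, ← jint_pow k hk]
    norm_num [jW]
  have hdisc : ∀ u ∈ Set.uIcc (-1 : ℝ) 1,
      0 ≤ (alph x₁ x₂ y₁ y₂ u) ^ 2 - 4 * x₁ * x₂ * y₁ * y₂ := by
    intro u hu
    rw [Set.uIcc_of_le (by norm_num)] at hu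
    have hA : alph x₁ x₂ y₁ y₂ u =
        (1 + u) / 2 * (x₁ * y₁ + x₂ * y₂) + (1 - u) / 2 * (x₁ * y₂ + x₂ * y₁) := by
      rw [alph]; ring
    have p1 : 0 ≤ (1 + u) / 2 := by linarith [hu.1]
    have p2 : 0 ≤ (1 - u) / 2 := by linarith [hu.2]
    set a := x₁ * y₁ with ha
    set b := x₂ * y₂ with hb
    set a' := x₁ * y₂ with ha'
    set b' := x₂ * y₁ with hb'
    have ha0 : 0 ≤ a := by positivity
    have hb0 : 0 ≤ b := by positivity
    have ha0' : 0 ≤ a' := by positivity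
    have hb0' : 0 ≤ b' := by positivity
    have e1 : 4 * x₁ * x₂ * y₁ * y₂ = 4 * (a * b) := by rw [ha, hb]; ring
    have e2 : a * b = a' * b' := by rw [ha, hb, ha', hb']; ring
    set r := 2 * √(a * b) with hr
    have hrs : r ^ 2 = 4 * (a * b) := by
      rw [hr, mul_pow, Real.sq_sqrt (by positivity)]; norm_num
    have hr0 : 0 ≤ r := by positivity
    have q1 : r ≤ a + b := abs_le_of_sq_le_sq' (by nlinarith [sq_nonneg (a - b)]) (by positivity) |>.2
    have q2 : r ≤ a' + b' :=
      abs_le_of_sq_le_sq' (by nlinarith [sq_nonneg (a' - b')]) (by positivity) |>.2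
    have q3 : r ≤ alph x₁ x₂ y₁ y₂ u := by
      rw [hA]
      nlinarith [mul_le_mul_of_nonneg_left q1 p1, mul_le_mul_of_nonneg_left q2 p2]
    rw [e1, ← hrs]
    nlinarith
  have hintegrand : ∀ u ∈ Set.uIcc (-1 : ℝ) 1,
      JackP k m ℓ (X1 x₁ x₂ y₁ y₂ u) (X2 x₁ x₂ y₁ y₂ u) * (1 - u ^ 2) ^ (k - 1) =
      (c * (x₁ * x₂ * (y₁ * y₂)) ^ ℓ) * (jG (jW k) m
        ((x₁ + x₂) / 2 * ((y₁ + y₂) / 2) + u * ((x₁ - x₂) / 2 * ((y₁ - y₂) / 2)))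
        (√((alph x₁ x₂ y₁ y₂ u) ^ 2 - 4 * x₁ * x₂ * y₁ * y₂) / 2) * jw k u) := by
    intro u hu
    rw [jackP_eq k hk, ← hc]
    have hs := Real.sq_sqrt (hdisc u hu)
    have e1 : X1 x₁ x₂ y₁ y₂ u * X2 x₁ x₂ y₁ y₂ u = x₁ * x₂ * (y₁ * y₂) := by
      rw [X1, X2]; linear_combination (-1 / 4 : ℝ) * hs
    have e2 : (X1 x₁ x₂ y₁ y₂ u + X2 x₁ x₂ y₁ y₂ u) / 2 =
        (x₁ + x₂) / 2 * ((y₁ + y₂) / 2) + u * ((x₁ - x₂) / 2 * ((y₁ - y₂) / 2)) := by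
      rw [X1, X2, alph]; ring
    have e3 : (X1 x₁ x₂ y₁ y₂ u - X2 x₁ x₂ y₁ y₂ u) / 2 =
        √((alph x₁ x₂ y₁ y₂ u) ^ 2 - 4 * x₁ * x₂ * y₁ * y₂) / 2 := by
      rw [X1, X2]; ring
    rw [e1, e2, e3, jw]; ring
  rw [intervalIntegral.integral_congr hintegrand, intervalIntegral.integral_const_mul,
    jprod k hk m ((x₁ + x₂) / 2) ((x₁ - x₂) / 2) ((y₁ + y₂) / 2) ((y₁ - y₂) / 2) _ (by
      intro u hu
      rw [div_pow, Real.sq_sqrt (hdisc u hu), alph]; ring), h11, jackP_eq k hk, jackP_eq k hk, ← hc]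
  have hWi : Real.Gamma (k + 1 / 2) / (Real.Gamma k * √π) = (jW k 0)⁻¹ := by
    rw [hW, inv_div]
  rw [hWi]
  field_simp
  simp only [mul_pow]
  ring
end
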